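/- Let N ≥ 1, k ≥ 1, let χ be a Dirichlet character modulo N of conductor m, let f ∈ M_k(Γ₀(N), χ), and let g = (A, B; C, D) ∈ SL₂(ℤ). Set N' = N/gcd(CD, N), m' = m/gcd(BC, m) and M = lcm(N', m'). Then every Fourier coefficient of f |_k g (in its expansion Σ_{n≥0} c_n e^{2πinτ/N}) lies in the subfield K_f(ζ_M) of ℂ generated by K_f and ζ_M. -/

import Mathlib

open Complex UpperHalfPlane CongruenceSubgroup
open scoped ModularForm MatrixGroups Real

noncomputable section

/-- `ζ_N = e^{2πi/N}`. -/
def zetaC (N : ℕ) : ℂ := Complex.exp (2 * Real.pi * Complex.I / N)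

/-- `f` has the Fourier expansion `Σ_{n ≥ 0} c n · e^{2πinτ/N}`. -/
def HasExpansion (N : ℕ) (f : ℍ → ℂ) (c : ℕ → ℂ) : Prop :=
  ∀ τ : ℍ, HasSum (fun n : ℕ => c n * Complex.exp (2 * Real.pi * Complex.I * n * (τ : ℂ) / N)) (f τ)

lemma he_iff {N : ℕ} {f : ℍ → ℂ} {c : ℕ → ℂ} : HasExpansion N f c ↔
    ∀ τ : ℍ, HasSum (fun n => c n • Function.Periodic.qParam (N : ℝ) τ ^ n) (f τ) := by
  unfold HasExpansion
  refine forall_congr' fun τ => ?_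
  have : (fun n : ℕ => c n * Complex.exp (2 * Real.pi * Complex.I * n * (τ : ℂ) / N)) =
      fun n => c n • Function.Periodic.qParam (N : ℝ) τ ^ n := by
    ext n
    rw [Function.Periodic.qParam, ← Complex.exp_nat_mul, smul_eq_mul]
    congr 2
    push_cast
    ring
  rw [this]

/-- pairs (function, q-expansion) -/
def ExRing (L : ℕ) : Subring ((ℍ → ℂ) × PowerSeries ℂ) where
  carrier := {x | HasExpansion L x.1 (fun n => PowerSeries.coeff n x.2)}
  zero_mem' := by
    intro τ
    simp
  one_mem' := by
    rw [Set.mem_ofPred_eq, he_iff]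
    intro τ
    have := hasSum_single (f := fun n => PowerSeries.coeff n (1 : PowerSeries ℂ) •
      Function.Periodic.qParam (L : ℝ) τ ^ n) 0 (by
        intro n hn
        simp [PowerSeries.coeff_one, hn])
    simpa using this
  add_mem' := by
    intro x y hx hy
    rw [Set.mem_ofPred_eq, he_iff] at *
    intro τ
    have := (hx τ).add (hy τ)
    simpa [add_mul] using this
  neg_mem' := by
    intro x hx
    rw [Set.mem_ofPred_eq, he_iff] at *
    intro τ
    have := (hx τ).neg
    simpa using this
  mul_mem' := by
    intro x y hx hy
    rw [Set.mem_ofPred_eq, he_iff] at *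
    intro τ
    have h1 := (hx τ)
    have h2 := (hy τ)
    have n1 := summable_norm_iff.mpr h1.summable
    have n2 := summable_norm_iff.mpr h2.summable
    have e := tsum_mul_tsum_eq_tsum_sum_antidiagonal_of_summable_norm n1 n2
    have s := (summable_norm_sum_mul_antidiagonal_of_summable_norm n1 n2).of_norm
    rw [h1.tsum_eq, h2.tsum_eq] at e
    have := s.hasSum
    rw [← e] at this
    refine this.congr_fun ?_
    intro n
    rw [Prod.snd_mul, PowerSeries.coeff_mul, Finset.sum_smul]
    refine Finset.sum_congr rfl fun p hp => ?_
    rw [← Finset.HasAntidiagonal.mem_antidiagonal.mp hp, pow_add]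
    simp only [smul_eq_mul]
    ring

lemma mem_ExRing {L : ℕ} {x} : x ∈ ExRing L ↔
  HasExpansion L x.1 (fun n => PowerSeries.coeff n x.2) := Iff.rfl

lemma ExRing_fst_inj {L : ℕ} (hL : 1 ≤ L) {x y : ExRing L} (h : x.1.1 = y.1.1) : x = y := by
  have hz := (x - y).2
  rw [mem_ExRing, he_iff] at hz
  have h0 : (x - y).1.1 = 0 := by simp [h]
  rw [h0] at hz
  have : ∀ m, PowerSeries.coeff m (x - y).1.2 = 0 := by
    intro m
    rw [qExpansion_coeff_unique (h := (L : ℝ)) (f := (0 : ModularForm 𝒮ℒ 0))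
      (c := fun n => PowerSeries.coeff n (x - y).1.2) (by positivity) ?_ hz m,
      FunLike.coe_zero, qExpansion_zero]
    · simp
    · rw [FunLike.coe_zero]
      have : cuspFunction (L : ℝ) (0 : ℍ → ℂ) = 0 := by
        ext z
        by_cases hz : z = 0
        · subst hz
          simp [cuspFunction, Function.Periodic.cuspFunction]
          exact Filter.Tendsto.limUnder_eq (by
            refine tendsto_const_nhds.congr' ?_
            filter_upwards [self_mem_nhdsWithin] with a ha
            simp)
        · simp [cuspFunction, Function.Periodic.cuspFunction, hz]
      rw [this]
      exact analyticAt_const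
  have h1 : (x - y).1.2 = 0 := by ext m; simpa using this m
  apply Subtype.ext
  apply Prod.ext h
  simpa [sub_eq_zero] using h1

lemma ExRing_snd_inj {L : ℕ} {x y : ExRing L} (h : x.1.2 = y.1.2) : x = y := by
  apply Subtype.ext
  refine Prod.ext ?_ h
  ext τ
  have h1 := x.2 τ
  have h2 := y.2 τ
  rw [h] at h1
  exact h1.unique h2

lemma he_unique {L : ℕ} (hL : 1 ≤ L) {F : ℍ → ℂ} {c d : ℕ → ℂ} (h1 : HasExpansion L F c)
    (h2 : HasExpansion L F d) : c = d := by
  have := ExRing_fst_inj hL (x := ⟨(F, PowerSeries.mk c), by simpa [mem_ExRing] using h1⟩)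
    (y := ⟨(F, PowerSeries.mk d), by simpa [mem_ExRing] using h2⟩) rfl
  ext n
  simpa using congrArg (fun z : ExRing L => PowerSeries.coeff n z.1.2) this

lemma he_bdd {L : ℕ} (hL : 1 ≤ L) {F : ℍ → ℂ} {c : ℕ → ℂ} (h1 : HasExpansion L F c) :
    IsBoundedAtImInfty F :=
  isBoundedAtImInfty_of_hasSum_qExpansion (h := (L : ℝ)) (by positivity) (he_iff.mp h1)

lemma he_holo {L : ℕ} (hL : 1 ≤ L) {F : ℍ → ℂ} {c : ℕ → ℂ} (h1 : HasExpansion L F c) :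
    MDifferentiable (modelWithCornersSelf ℂ ℂ) (modelWithCornersSelf ℂ ℂ) F := by
  rw [UpperHalfPlane.mdifferentiable_iff]
  intro z hz
  have hz : 0 < z.im := hz
  set U : Set ℂ := {w | z.im / 2 < w.im} with hU
  have hUo : IsOpen U := isOpen_lt continuous_const Complex.continuous_im
  have hzU : z ∈ U := by simp [hU]; linarith
  have hLpos : (0 : ℝ) < L := by positivity
  let τ0 : ℍ := ⟨⟨0, z.im / 2⟩, by simpa using hz⟩
  have hd : DifferentiableOn ℂ (fun w => ∑' n : ℕ, c n *
      Complex.exp (2 * Real.pi * Complex.I * n * w / L)) U := by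
    refine differentiableOn_tsum_of_summable_norm (summable_norm_iff.mpr (h1 τ0).summable) ?_ hUo ?_
    · intro n
      fun_prop
    · intro n w hw
      rw [norm_mul, norm_mul, Complex.norm_exp, Complex.norm_exp]
      refine mul_le_mul_of_nonneg_left (Real.exp_le_exp.mpr ?_) (norm_nonneg _)
      have hre : ∀ u : ℂ, (2 * Real.pi * Complex.I * n * u / L).re = -(2 * π * n / L * u.im) := by
        intro u
        have : 2 * Real.pi * Complex.I * n * u / L =
          ((2 * π * n / L : ℝ) : ℂ) * (Complex.I * u) := by push_cast; ring
        rw [this, Complex.re_ofReal_mul]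
        simp
      rw [hre, hre]
      have : (τ0 : ℂ).im ≤ w.im := le_of_lt hw
      have h0 : 0 ≤ 2 * π * n / L := by positivity
      nlinarith [mul_le_mul_of_nonneg_left this h0]
  have := (hd.differentiableAt (hUo.mem_nhds hzU))
  refine (this.congr_of_eventuallyEq ?_).differentiableWithinAt
  filter_upwards [hUo.mem_nhds hzU] with w hw
  have hw' : 0 < w.im := by
    have : z.im / 2 < w.im := hw
    linarith
  have := (h1 ⟨w, hw'⟩).tsum_eq
  rw [Function.comp, ofComplex_apply_of_im_pos hw', ← this]

lemma he_expand {N d : ℕ} (hd : 1 ≤ d) (hN : 1 ≤ N) {F : ℍ → ℂ} {c : ℕ → ℂ}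
    (h1 : HasExpansion N F c) :
    HasExpansion (N * d) F (fun n => if d ∣ n then c (n / d) else 0) := by
  intro τ
  have hinj : Function.Injective (fun n : ℕ => d * n) := fun a b h => Nat.eq_of_mul_eq_mul_left hd h
  rw [← hinj.hasSum_iff]
  · convert h1 τ using 1
    ext n
    have : (d : ℂ) ≠ 0 := by exact_mod_cast (by omega : d ≠ 0)
    have : (N : ℂ) ≠ 0 := by exact_mod_cast (by omega : N ≠ 0)
    simp only [Function.comp, dvd_mul_right, if_true, Nat.mul_div_cancel_left n hd]
    congr 2
    push_cast
    field_simp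
  · intro n hn
    beta_reduce
    rw [if_neg, zero_mul]
    rintro ⟨m, rfl⟩
    exact hn ⟨m, rfl⟩

/-- `F'` is the `σ`-conjugate of `F` -/
def Tw (L : ℕ) (σ : ℂ →+* ℂ) (F F' : ℍ → ℂ) : Prop :=
  ∃ p : PowerSeries ℂ, (F, p) ∈ ExRing L ∧ (F', PowerSeries.map σ p) ∈ ExRing L

lemma Tw.add {L : ℕ} {σ : ℂ →+* ℂ} {F F' G G' : ℍ → ℂ} (h1 : Tw L σ F F') (h2 : Tw L σ G G') :
    Tw L σ (F + G) (F' + G') := by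
  obtain ⟨p, hp, hp'⟩ := h1
  obtain ⟨q, hq, hq'⟩ := h2
  have e1 := (ExRing L).add_mem hp hq
  have e2 := (ExRing L).add_mem hp' hq'
  rw [Prod.mk_add_mk] at e1 e2
  rw [← map_add] at e2
  exact ⟨_, e1, e2⟩

lemma Tw.sub {L : ℕ} {σ : ℂ →+* ℂ} {F F' G G' : ℍ → ℂ} (h1 : Tw L σ F F') (h2 : Tw L σ G G') :
    Tw L σ (F - G) (F' - G') := by
  obtain ⟨p, hp, hp'⟩ := h1
  obtain ⟨q, hq, hq'⟩ := h2
  have e1 := (ExRing L).sub_mem hp hq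
  have e2 := (ExRing L).sub_mem hp' hq'
  rw [Prod.mk_sub_mk] at e1 e2
  rw [← map_sub] at e2
  exact ⟨_, e1, e2⟩

lemma Tw.mul {L : ℕ} {σ : ℂ →+* ℂ} {F F' G G' : ℍ → ℂ} (h1 : Tw L σ F F') (h2 : Tw L σ G G') :
    Tw L σ (F * G) (F' * G') := by
  obtain ⟨p, hp, hp'⟩ := h1
  obtain ⟨q, hq, hq'⟩ := h2
  have e1 := (ExRing L).mul_mem hp hq
  have e2 := (ExRing L).mul_mem hp' hq'
  rw [Prod.mk_mul_mk] at e1 e2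
  rw [← map_mul] at e2
  exact ⟨_, e1, e2⟩

lemma const_mem_ExRing (L : ℕ) (c : ℂ) : ((fun _ => c : ℍ → ℂ), PowerSeries.C c) ∈ ExRing L := by
  rw [mem_ExRing, he_iff]
  intro τ
  have := hasSum_single (f := fun n => PowerSeries.coeff n (PowerSeries.C c) •
      Function.Periodic.qParam (L : ℝ) τ ^ n) 0 (by
        intro n hn
        simp [PowerSeries.coeff_C, hn])
  simpa using this

lemma Tw.const (L σ) (c : ℂ) : Tw L σ (fun _ => c) (fun _ => σ c) :=
  ⟨PowerSeries.C c, const_mem_ExRing L c, by simpa using const_mem_ExRing L (σ c)⟩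

lemma levelOne_he {L : ℕ} (hL : 1 ≤ L) {k : ℤ} (F : ModularForm 𝒮ℒ k) : HasExpansion L F
    (fun n => if L ∣ n then (qExpansion 1 F).coeff (n / L) else 0) := by
  have h1 : HasExpansion 1 F (fun n => (qExpansion 1 F).coeff n) := by
    rw [he_iff]
    intro τ
    have := ModularForm.hasSum_qExpansion (f := F) (h := 1) one_pos one_mem_strictPeriods_SL τ
    simpa using this
  have := he_expand (d := L) hL le_rfl h1
  simpa using this

lemma Tw.E {L : ℕ} (hL : 1 ≤ L) (σ) {k : ℕ} (hk : 3 ≤ k) (hk2 : Even k) :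
    Tw L σ (ModularForm.E hk) (ModularForm.E hk) := by
  have := levelOne_he hL (ModularForm.E hk)
  refine ⟨PowerSeries.mk _, by simpa [mem_ExRing] using this, ?_⟩
  rw [mem_ExRing]
  convert this using 2 with n
  simp only [PowerSeries.coeff_map, PowerSeries.coeff_mk]
  split_ifs
  · rw [EisensteinSeries.E_qExpansion_coeff hk hk2]
    have h2 : σ 2 = 2 := map_ofNat σ 2
    split_ifs <;> simp [h2]
  · simp

lemma Tw.Delta {L : ℕ} (hL : 1 ≤ L) (σ) :
    Tw L σ ModularForm.discriminant ModularForm.discriminant := by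
  have h4 := Tw.E hL σ (k := 4) (by norm_num) ⟨2, rfl⟩
  have h6 := Tw.E hL σ (k := 6) (by norm_num) ⟨3, rfl⟩
  have := (Tw.const L σ (1 / 1728)).mul (((h4.mul h4).mul h4).sub (h6.mul h6))
  convert this using 1
  · ext z
    rw [ModularForm.discriminant_eq_E₄_cube_sub_E₆_sq]
    simp
    ring
  · ext z
    rw [ModularForm.discriminant_eq_E₄_cube_sub_E₆_sq]
    have h2 : σ 1728 = 1728 := map_ofNat σ 1728
    simp [h2]
    ring

lemma levelOne_twist {L : ℕ} (hL : 1 ≤ L) (σ) (n : ℕ) : ∀ (k : ℤ), k < 12 * n →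
    ∀ F : ModularForm 𝒮ℒ k, ∃ F' : ModularForm 𝒮ℒ k, Tw L σ F F' := by
  have hzero : ∀ (k : ℤ) (F : ModularForm 𝒮ℒ k), F = 0 → ∃ F' : ModularForm 𝒮ℒ k, Tw L σ F F' := by
    rintro k F rfl
    refine ⟨0, ?_⟩
    have := Tw.const L σ 0
    rw [map_zero] at this
    exact this
  have hneg : ∀ (k : ℤ) (F : ModularForm 𝒮ℒ k), k < 0 → F = 0 := by
    intro k F hk
    have := ModularFormClass.levelOne_neg_weight_eq_zero hk F
    exact DFunLike.coe_injective (by simpa using this)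
  induction n with
  | zero => exact fun k hk F => hzero k F (hneg k F (by simpa using hk))
  | succ n ih =>
    intro k hk F
    by_cases h0 : k < 0
    · exact hzero k F (hneg k F h0)
    by_cases hodd : Odd k
    · exact hzero k F (ModularForm.levelOne_odd_weight_eq_zero hodd F)
    obtain ⟨m, rfl⟩ : ∃ m : ℕ, k = m := ⟨k.toNat, by omega⟩
    have heven : Even m := by
      rcases Nat.even_or_odd m with h | h
      · exact h
      · exact absurd (by exact_mod_cast h) hodd
    by_cases hm0 : m = 0
    · subst hm0
      obtain ⟨c, hc⟩ := ModularFormClass.levelOne_weight_zero_const (F := ModularForm 𝒮ℒ 0) F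
      refine ⟨(ModularForm.const (σ c) : ModularForm 𝒮ℒ 0), ?_⟩
      have := Tw.const L σ c
      convert this using 1
      · exact hc
      · rfl
    by_cases hm2 : m = 2
    · subst hm2
      have := rank_zero_iff.mp ModularForm.levelOne_weight_two_rank_zero
      exact hzero _ F (Subsingleton.elim _ _)
    have hm : 3 ≤ m := by
      obtain ⟨r, rfl⟩ := heven
      omega
    set a := (qExpansion 1 F).coeff 0 with ha
    set F1 : ModularForm 𝒮ℒ m := F - a • ModularForm.E hm with hF1
    have hcusp : (qExpansion 1 F1).coeff 0 = 0 := by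
      rw [hF1, FunLike.coe_sub, ModularForm.qExpansion_sub one_pos one_mem_strictPeriods_SL,
        FunLike.coe_smul, ModularForm.qExpansion_smul one_pos one_mem_strictPeriods_SL, map_sub,
        PowerSeries.coeff_smul,
        EisensteinSeries.E_qExpansion_coeff_zero hm heven, ← ha]
      simp
    set G := CuspForm.discriminantEquiv (ModularForm.toCuspForm F1 hcusp) with hG
    obtain ⟨G', hG'⟩ := ih (m - 12) (by push_cast at hk; linarith) G
    refine ⟨σ a • ModularForm.E hm + CuspForm.toModularFormₗ (CuspForm.ofMulDiscriminant G'), ?_⟩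
    have := ((Tw.const L σ a).mul (Tw.E hL σ hm heven)).add ((Tw.Delta hL σ).mul hG')
    convert this using 1
    · rw [hG, ModularForm.discriminant_mul_discriminantEquiv]
      ext z
      simp [hF1]
    · ext z
      simp

/-- lattice sum in one dimension -/
def WW (z : ℂ) : ℂ := ∑' n : ℤ, 1 / (z + n) ^ 3

def CC : ℂ := (-2 * π * Complex.I) ^ 3 / 2

def Phi (x : ℂ) : ℂ := x * (1 + x) / (1 - x) ^ 3

lemma CC_ne : CC ≠ 0 := by
  have := Real.pi_ne_zero
  simp [CC, this]

lemma WW_up (z : ℍ) : WW z = ∑' n : ℕ+, CC * (n ^ 2 * cexp (2 * π * Complex.I * z) ^ (n : ℕ)) := by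
  rw [tsum_mul_left]
  exact EisensteinSeries.qExpansion_identity_pnat (k := 2) (by norm_num) z

lemma WW_neg (z : ℂ) : WW (-z) = - WW z := by
  unfold WW
  rw [← (Equiv.neg ℤ).tsum_eq, ← tsum_neg]
  congr 1
  ext n
  have : -z + ((Equiv.neg ℤ) n : ℤ) = -(z + n) := by
    push_cast [Equiv.neg_apply]; ring
  rw [this, Odd.neg_pow (by decide), div_neg]

lemma hasSum_sq_geom {x : ℂ} (hx : ‖x‖ < 1) : HasSum (fun n : ℕ => (n : ℂ) ^ 2 * x ^ n) (Phi x) := by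
  have h2 := hasSum_choose_mul_geometric_of_norm_lt_one 2 hx
  have h1 := hasSum_choose_mul_geometric_of_norm_lt_one 1 hx
  have h0 := hasSum_choose_mul_geometric_of_norm_lt_one 0 hx
  have hne : 1 - x ≠ 0 := by
    intro h
    have : x = 1 := by linear_combination -h
    rw [this] at hx
    simp at hx
  have := ((h2.mul_left 2).sub (h1.mul_left 3)).add h0
  have e0 : Phi x = 2 * (1 / (1 - x) ^ (2 + 1)) - 3 * (1 / (1 - x) ^ (1 + 1)) + 1 / (1 - x) ^ (0 + 1) := by
    unfold Phi
    field_simp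
    ring
  rw [e0]
  refine (funext fun n => ?_ : (fun n : ℕ => (n : ℂ) ^ 2 * x ^ n) = _) ▸ this
  have e : ((Nat.choose (n + 2) 2 : ℕ) : ℂ) = (n + 2) * (n + 1) / 2 := by
    rw [Nat.cast_choose_two]
    push_cast
    ring
  rw [Nat.choose_one_right, Nat.choose_zero_right, e]
  push_cast
  ring

lemma WW_up' (z : ℍ) : WW z = CC * Phi (cexp (2 * π * Complex.I * z)) := by
  rw [WW, EisensteinSeries.qExpansion_identity (k := 2) (by norm_num) z,
    (hasSum_sq_geom (UpperHalfPlane.norm_exp_two_pi_I_lt_one z)).tsum_eq]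
  rfl

open Filter Topology in
lemma WW_real (r : ℝ) (hr : cexp (2 * π * Complex.I * r) ≠ 1) : WW r = CC * Phi (cexp (2 * π * Complex.I * r)) := by
  have hrn : ∀ n : ℤ, r + n ≠ 0 := by
    intro n hn
    apply hr
    rw [Complex.exp_eq_one_iff]
    refine ⟨-n, ?_⟩
    have : r = -n := by linarith
    rw [this]; push_cast; ring
  have hne' : (1 - cexp (2 * π * Complex.I * r)) ≠ 0 := by
    intro h; apply hr; linear_combination -h
  have h1 : Tendsto (fun t : ℝ => WW (r + t * Complex.I)) (𝓝[>] 0) (𝓝 (WW r)) := by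
    unfold WW
    refine tendsto_tsum_of_dominated_convergence (bound := fun n : ℤ => ‖1 / ((r : ℂ) + n) ^ 3‖) ?_ ?_ ?_
    · have := EisensteinSeries.linear_right_summable (r : ℂ) 1 (k := 3) (by norm_num)
      have := this.norm
      refine this.congr fun n => ?_
      norm_cast
      simp
    · intro n
      have : ContinuousAt (fun t : ℝ => 1 / ((r : ℂ) + t * Complex.I + n) ^ 3) 0 := by
        apply ContinuousAt.div continuousAt_const (by fun_prop)
        have := hrn n
        simp
        exact_mod_cast this
      have h := this.tendsto
      simp only [ofReal_zero, zero_mul, add_zero] at h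
      exact h.mono_left nhdsWithin_le_nhds
    · refine Eventually.of_forall fun t n => ?_
      rw [norm_div, norm_div, norm_pow, norm_pow]
      have h3 : ‖(r : ℂ) + n‖ ≤ ‖(r : ℂ) + t * Complex.I + n‖ := by
        have e1 : ((r : ℂ) + n) = ((r + n : ℝ) : ℂ) := by push_cast; ring
        have e2 : ((r : ℂ) + t * Complex.I + n) = ((r + n : ℝ) : ℂ) + t * Complex.I := by push_cast; ring
        rw [e1, e2, Complex.norm_real]
        have := Complex.abs_re_le_norm (((r + n : ℝ) : ℂ) + t * Complex.I)
        simpa using this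
      have h4 : 0 < ‖(r : ℂ) + n‖ := by
        rw [norm_pos_iff]
        exact_mod_cast hrn n
      gcongr
  have h2 : Tendsto (fun t : ℝ => WW (r + t * Complex.I)) (𝓝[>] 0) (𝓝 (CC * Phi (cexp (2 * π * Complex.I * r)))) := by
    have hc : ContinuousAt (fun t : ℝ => CC * Phi (cexp (2 * π * Complex.I * (r + t * Complex.I)))) 0 := by
      unfold Phi
      refine ContinuousAt.mul continuousAt_const (ContinuousAt.div (by fun_prop) (by fun_prop) ?_)
      simpa using hne'
    have h := hc.tendsto
    simp only [ofReal_zero, zero_mul, add_zero] at h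
    refine (h.mono_left nhdsWithin_le_nhds).congr' ?_
    filter_upwards [self_mem_nhdsWithin] with t ht
    have := WW_up' ⟨r + t * Complex.I, by simpa using ht⟩
    exact this.symm
  exact tendsto_nhds_unique h1 h2

open EisensteinSeries in
/-- level `L` weight 3 Eisenstein series -/
def GG (L : ℕ) (v : Fin 2 → ZMod L) (τ : ℍ) : ℂ := ((L : ℂ) ^ 3 / CC) *
  ∑' x : Fin 2 → ℤ, if (fun i => (x i : ZMod L)) = v then eisSummand 3 x τ else 0

def actv {L : ℕ} (v : Fin 2 → ZMod L) (γ : SL(2, ℤ)) : Fin 2 → ZMod L :=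
  ![v 0 * (γ 0 0 : ℤ) + v 1 * (γ 1 0 : ℤ), v 0 * (γ 0 1 : ℤ) + v 1 * (γ 1 1 : ℤ)]

lemma actv_eq {L : ℕ} (v : Fin 2 → ZMod L) (γ : SL(2, ℤ)) :
    actv v γ = Matrix.vecMul v ((γ : Matrix (Fin 2) (Fin 2) ℤ).map (Int.cast : ℤ → ZMod L)) := by
  ext i
  fin_cases i <;> simp [actv, Matrix.vecMul, dotProduct, Fin.sum_univ_two]

lemma actv_mul {L : ℕ} (v : Fin 2 → ZMod L) (γ δ : SL(2, ℤ)) :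
    actv v (γ * δ) = actv (actv v γ) δ := by
  ext i
  fin_cases i <;> simp [actv, Matrix.mul_apply, Fin.sum_univ_two] <;> ring

lemma actv_one {L : ℕ} (v : Fin 2 → ZMod L) : actv v 1 = v := by
  ext i
  fin_cases i <;> simp [actv]

lemma actv_inj {L : ℕ} {v w : Fin 2 → ZMod L} {γ : SL(2, ℤ)} (h : actv v γ = actv w γ) : v = w := by
  have := congrArg (fun u => actv u γ⁻¹) h
  simpa [← actv_mul, actv_one] using this

open EisensteinSeries in
lemma GG_slash (L : ℕ) (v : Fin 2 → ZMod L) (γ : SL(2, ℤ)) (τ : ℍ) :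
    GG L v (γ • τ) = (denom γ τ) ^ 3 * GG L (actv v γ) τ := by
  unfold GG
  have key : ∀ x : Fin 2 → ℤ, (if (fun i => (x i : ZMod L)) = v then eisSummand 3 x (γ • τ) else 0)
      = (denom γ τ) ^ 3 * (if (fun i => ((Matrix.vecMul x (γ : Matrix (Fin 2) (Fin 2) ℤ)) i : ZMod L)) = actv v γ
          then eisSummand 3 (Matrix.vecMul x (γ : Matrix (Fin 2) (Fin 2) ℤ)) τ else 0) := by
    intro x
    have e : (fun i => ((Matrix.vecMul x (γ : Matrix (Fin 2) (Fin 2) ℤ)) i : ZMod L))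
        = actv (fun i => (x i : ZMod L)) γ := by
      ext i
      fin_cases i <;> simp [actv, Matrix.vecMul, dotProduct, Fin.sum_univ_two]
    rw [e]
    by_cases h : (fun i => (x i : ZMod L)) = v
    · rw [if_pos h, if_pos (by rw [h]), eisSummand_SL2_apply]
      norm_cast
    · rw [if_neg h, if_neg (fun h' => h (actv_inj h')), mul_zero]
  simp_rw [key]
  rw [tsum_mul_left]
  let e : (Fin 2 → ℤ) ≃ (Fin 2 → ℤ) :=
    { toFun := fun x => Matrix.vecMul x (γ : Matrix (Fin 2) (Fin 2) ℤ)
      invFun := fun x => Matrix.vecMul x ((γ⁻¹ : SL(2, ℤ)) : Matrix (Fin 2) (Fin 2) ℤ)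
      left_inv := fun x => by
        beta_reduce; rw [Matrix.vecMul_vecMul, ← Matrix.SpecialLinearGroup.coe_mul]; simp
      right_inv := fun x => by
        beta_reduce; rw [Matrix.vecMul_vecMul, ← Matrix.SpecialLinearGroup.coe_mul]; simp }
  have := e.tsum_eq (fun x : Fin 2 → ℤ => if (fun i => (x i : ZMod L)) = actv v γ
          then eisSummand 3 x τ else 0)
  rw [← this]
  simp only [e, Equiv.coe_fn_mk]
  ring

/-- Fourier coefficients -/
def sc (L : ℕ) [NeZero L] (v : Fin 2 → ZMod L) (n : ℕ) : ℂ :=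
  if n = 0 then (if v 0 = 0 then Phi (ZMod.stdAddChar (v 1)) else 0)
  else ∑ x ∈ n.divisorsAntidiagonal, (x.2 : ℂ) ^ 2 *
    ((if (x.1 : ZMod L) = v 0 then ZMod.stdAddChar ((x.2 : ZMod L) * v 1) else 0)
      - (if (x.1 : ZMod L) = - v 0 then ZMod.stdAddChar (-((x.2 : ZMod L) * v 1)) else 0))

open EisensteinSeries in
lemma GG_inner (L : ℕ) [NeZero L] (v : Fin 2 → ZMod L) (τ : ℍ) (c : ℤ) :
    ∑' d : ℤ, (if (fun i => ((![c, d] i : ℤ) : ZMod L)) = v then eisSummand 3 ![c, d] τ else 0)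
    = if (c : ZMod L) = v 0 then ((L : ℂ) ^ 3)⁻¹ * WW ((c * τ + ((v 1).val : ℕ)) / L) else 0 := by
  have hL : (L : ℂ) ≠ 0 := by exact_mod_cast NeZero.ne L
  have hcond : ∀ d : ℤ, ((fun i => ((![c, d] i : ℤ) : ZMod L)) = v) ↔ ((c : ZMod L) = v 0 ∧ (d : ZMod L) = v 1) := by
    intro d
    rw [funext_iff, Fin.forall_fin_two]
    simp
  simp_rw [hcond]
  by_cases hc : (c : ZMod L) = v 0
  · rw [if_pos hc]
    simp only [hc, true_and]
    have hinj : Function.Injective (fun n : ℤ => ((v 1).val : ℤ) + L * n) := by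
      intro a b h
      simpa [NeZero.ne L] using h
    rw [← hinj.tsum_eq]
    · unfold WW
      rw [← tsum_mul_left]
      refine tsum_congr fun n => ?_
      rw [if_pos (by simp)]
      simp only [eisSummand, Matrix.cons_val_zero, Matrix.cons_val_one, zpow_neg]
      rw [one_div, ← mul_inv, ← mul_pow]
      norm_cast
      congr 2
      push_cast
      field_simp
      ring
    · intro d hd
      have hd' : (d : ZMod L) = v 1 := by
        by_contra h
        simp [h] at hd
      have h2 : ((d - (v 1).val : ℤ) : ZMod L) = 0 := by
        push_cast
        rw [hd']
        simp
      rw [ZMod.intCast_zmod_eq_zero_iff_dvd] at h2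
      obtain ⟨n, hn⟩ := h2
      exact ⟨n, by simp only; linarith⟩
  · simp [hc]

lemma char_val {L : ℕ} [NeZero L] (b : ZMod L) :
    ZMod.stdAddChar b = cexp (2 * π * Complex.I * (b.val : ℕ) / L) := by
  have := ZMod.stdAddChar_coe (N := L) ((b.val : ℕ) : ℤ)
  simpa using this

/-- the double series term -/
def dterm (L : ℕ) [NeZero L] (v : Fin 2 → ZMod L) (τ : ℍ) (x : ℕ × ℕ) : ℂ :=
  (x.2 : ℂ) ^ 2 *
    ((if (x.1 : ZMod L) = v 0 then ZMod.stdAddChar ((x.2 : ZMod L) * v 1) else 0)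
      - (if (x.1 : ZMod L) = - v 0 then ZMod.stdAddChar (-((x.2 : ZMod L) * v 1)) else 0)) *
      Function.Periodic.qParam (L : ℝ) τ ^ (x.1 * x.2)

lemma qParam_lt {L : ℕ} [NeZero L] (τ : ℍ) : ‖Function.Periodic.qParam (L : ℝ) τ‖ < 1 :=
  UpperHalfPlane.norm_qParam_lt_one (L : ℕ) τ

lemma norm_stdAddChar {L : ℕ} [NeZero L] (b : ZMod L) : ‖ZMod.stdAddChar b‖ = 1 := by
  rw [ZMod.stdAddChar_apply]; exact Circle.norm_coe _

lemma summable_dterm (L : ℕ) [NeZero L] (v : Fin 2 → ZMod L) (τ : ℍ) :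
    Summable (fun x : ℕ+ × ℕ+ => dterm L v τ (x.1, x.2)) := by
  have h := (summable_prod_mul_pow 2 (qParam_lt (L := L) τ)).norm.mul_left 2
  refine Summable.of_norm_bounded h fun x => ?_
  unfold dterm
  rw [norm_mul, norm_mul, norm_mul, mul_comm ‖((x.2 : ℕ) : ℂ) ^ 2‖, mul_assoc]
  gcongr
  refine (norm_sub_le _ _).trans ?_
  have : ∀ (p : Prop) [Decidable p] (b : ZMod L), ‖(if p then ZMod.stdAddChar b else 0 : ℂ)‖ ≤ 1 := by
    intro p _ b
    split_ifs
    · rw [norm_stdAddChar]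
    · simp
  have h1 := this ((((x.1 : ℕ) : ZMod L)) = v 0) (((x.2 : ℕ) : ZMod L) * v 1)
  have h2 := this ((((x.1 : ℕ) : ZMod L)) = - v 0) (-(((x.2 : ℕ) : ZMod L) * v 1))
  linarith

lemma exp_split (L : ℕ) [NeZero L] (τ : ℍ) (b : ZMod L) (c m : ℕ) :
    cexp (2 * π * Complex.I * ((c * τ + (b.val : ℕ)) / L)) ^ m
     = ZMod.stdAddChar ((m : ZMod L) * b) * Function.Periodic.qParam (L : ℝ) τ ^ (c * m) := by
  have hL : (L : ℂ) ≠ 0 := by exact_mod_cast NeZero.ne L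
  have e : (m : ZMod L) * b = m • b := by simp
  rw [e, AddChar.map_nsmul_eq_pow, char_val, pow_mul, ← mul_pow]
  congr 1
  rw [Function.Periodic.qParam, ← Complex.exp_nat_mul, ← Complex.exp_add]
  congr 1
  push_cast
  field_simp
  ring

lemma WW_pos (L : ℕ) [NeZero L] (τ : ℍ) (b : ZMod L) (c : ℕ+) :
    WW ((((c : ℕ) : ℂ) * τ + (b.val : ℕ)) / L) = CC * ∑' m : ℕ+, (m : ℂ) ^ 2 *
      (ZMod.stdAddChar (((m : ℕ) : ZMod L) * b) * Function.Periodic.qParam (L : ℝ) τ ^ ((c : ℕ) * m)) := by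
  have hL : (0 : ℝ) < L := by exact_mod_cast Nat.pos_of_ne_zero (NeZero.ne L)
  have him : 0 < ((((c : ℕ) : ℂ) * τ + (b.val : ℕ)) / L).im := by
    have e : ((((c : ℕ) : ℂ) * τ + (b.val : ℕ)) / L) = (((c : ℕ) / L : ℝ) : ℂ) * τ + ((b.val / L : ℝ) : ℂ) := by
      push_cast; ring
    rw [e]
    simp only [add_im, ofReal_im, add_zero, im_ofReal_mul]
    have := τ.im_pos
    have hc : (0 : ℝ) < (c : ℕ) := by exact_mod_cast c.pos
    have : 0 < (τ : ℂ).im := τ.im_pos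
    positivity
  have := WW_up ⟨_, him⟩
  rw [tsum_mul_left] at this
  simp only at this
  rw [this]
  congr 1
  refine tsum_congr fun m => ?_
  rw [exp_split]

lemma WW_per (z : ℂ) (n : ℤ) : WW (z + n) = WW z := by
  unfold WW
  rw [← (Equiv.addLeft n).tsum_eq (fun m : ℤ => 1 / (z + m) ^ 3)]
  refine tsum_congr fun m => ?_
  simp [add_assoc]

lemma WW_negc (L : ℕ) [NeZero L] (τ : ℍ) (b : ZMod L) (c : ℕ+) :
    WW (((-((c : ℕ) : ℂ)) * τ + (b.val : ℕ)) / L) = - (CC * ∑' m : ℕ+, (m : ℂ) ^ 2 *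
      (ZMod.stdAddChar (-(((m : ℕ) : ZMod L) * b)) * Function.Periodic.qParam (L : ℝ) τ ^ ((c : ℕ) * m))) := by
  have hL : (L : ℂ) ≠ 0 := by exact_mod_cast NeZero.ne L
  have h := WW_pos L τ (-b) c
  simp only [mul_neg] at h
  rw [← h, ← WW_neg]
  have h2 : ((((-b).val + b.val : ℕ) : ℤ) : ZMod L) = 0 := by
    push_cast; simp
  rw [ZMod.intCast_zmod_eq_zero_iff_dvd] at h2
  obtain ⟨n, hn⟩ := h2
  rw [← WW_per _ (-n)]
  congr 1
  have hn' : (((-b).val : ℕ) : ℂ) + (b.val : ℕ) = L * n := by exact_mod_cast hn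
  push_cast
  field_simp
  linear_combination hn'

open EisensteinSeries in
lemma GG_eq (L : ℕ) [NeZero L] (v : Fin 2 → ZMod L) (hv : v 0 = 0 → v 1 ≠ 0) (τ : ℍ) :
    GG L v τ = sc L v 0 + ∑' x : ℕ+ × ℕ+, dterm L v τ (x.1, x.2) := by
  have hL : (L : ℂ) ≠ 0 := by exact_mod_cast NeZero.ne L
  have hC := CC_ne
  set f : ℤ × ℤ → ℂ := fun x => if (fun i => ((![x.1, x.2] i : ℤ) : ZMod L)) = v then
    eisSummand 3 ![x.1, x.2] τ else 0 with hf
  have hsum : Summable f := by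
    refine Summable.of_norm_bounded (summable_prod_eisSummand (k := 3) le_rfl τ).norm fun x => ?_
    simp only [hf]
    split_ifs
    · exact le_rfl
    · simp
  have h1 : ∑' x : Fin 2 → ℤ, (if (fun i => (x i : ZMod L)) = v then eisSummand 3 x τ else 0)
      = ∑' c : ℤ, if (c : ZMod L) = v 0 then ((L : ℂ) ^ 3)⁻¹ * WW ((c * τ + ((v 1).val : ℕ)) / L) else 0 := by
    rw [← (finTwoArrowEquiv ℤ).symm.tsum_eq, finTwoArrowEquiv_symm_apply]
    change ∑' x, f x = _
    rw [Summable.tsum_prod hsum]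
    exact tsum_congr fun c => GG_inner L v τ c
  have hsum2 : Summable fun c : ℤ => if (c : ZMod L) = v 0 then ((L : ℂ) ^ 3)⁻¹ * WW ((c * τ + ((v 1).val : ℕ)) / L) else 0 := by
    refine hsum.prod.congr fun c => ?_
    exact (GG_inner L v τ c)
  unfold GG
  rw [h1, tsum_int_eq_zero_add_tsum_pnat hsum2, mul_add, mul_add, add_assoc]
  congr 1
  · simp only [Int.cast_zero, zero_mul, zero_add, sc, if_true]
    by_cases h0 : v 0 = 0
    · rw [if_pos h0.symm, if_pos h0]
      have hr := WW_real ((v 1).val / L : ℝ)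
      have e : cexp (2 * π * Complex.I * (((v 1).val / L : ℝ) : ℂ)) = ZMod.stdAddChar (v 1) := by
        rw [char_val]; congr 1; push_cast; ring
      rw [e] at hr
      have hne : ZMod.stdAddChar (v 1) ≠ 1 := by
        intro h
        apply hv h0
        apply ZMod.injective_stdAddChar
        rw [h]; simp
      have := hr hne
      push_cast at this
      rw [this]
      field_simp
    · rw [if_neg (fun h => h0 h.symm), if_neg h0, mul_zero]
  · rw [(summable_dterm L v τ).tsum_prod]
    have hs1 : Summable fun c : ℕ+ => (L : ℂ) ^ 3 / CC * (if (((c : ℕ) : ℤ) : ZMod L) = v 0 then ((L : ℂ) ^ 3)⁻¹ * WW (((((c : ℕ) : ℤ) : ℂ) * τ + ((v 1).val : ℕ)) / L) else 0) := by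
      refine Summable.mul_left _ (hsum2.comp_injective (i := fun c : ℕ+ => ((c : ℕ) : ℤ)) ?_)
      intro a b h
      exact PNat.coe_injective (by simpa using h)
    have hs2 : Summable fun c : ℕ+ => (L : ℂ) ^ 3 / CC * (if ((-((c : ℕ) : ℤ) : ℤ) : ZMod L) = v 0 then ((L : ℂ) ^ 3)⁻¹ * WW ((((-((c : ℕ) : ℤ) : ℤ) : ℂ) * τ + ((v 1).val : ℕ)) / L) else 0) := by
      refine Summable.mul_left _ (hsum2.comp_injective (i := fun c : ℕ+ => -((c : ℕ) : ℤ)) ?_)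
      intro a b h
      exact PNat.coe_injective (by simpa using h)
    rw [← tsum_mul_left, ← tsum_mul_left, ← hs1.tsum_add hs2]
    refine tsum_congr fun c => ?_
    have hsq : ∀ g : ℕ+ → ZMod L, Summable fun m : ℕ+ => (m : ℂ) ^ 2 * (ZMod.stdAddChar (g m) * Function.Periodic.qParam (L : ℝ) τ ^ ((c : ℕ) * m)) := by
      intro g
      have := (summable_prod_mul_pow 2 (qParam_lt (L := L) τ)).norm.comp_injective (i := fun m : ℕ+ => (c, m)) (by
        intro a b h; simpa using h)
      refine Summable.of_norm_bounded this fun m => ?_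
      simp only [norm_mul, norm_stdAddChar, one_mul, Function.comp]
      exact le_rfl
    have e1 : ((-((c : ℕ) : ℤ) : ℤ) : ZMod L) = v 0 ↔ ((c : ℕ) : ZMod L) = - v 0 := by
      push_cast
      constructor <;> intro h
      · rw [← h]; ring
      · rw [h]; ring
    have e2 : ((((c : ℕ) : ℤ) : ZMod L) = v 0) ↔ ((c : ℕ) : ZMod L) = v 0 := by
      push_cast; rfl
    simp only [e1, e2, dterm]
    push_cast
    rw [WW_pos, WW_negc]
    by_cases h1 : ((c : ℕ) : ZMod L) = v 0 <;> by_cases h2 : ((c : ℕ) : ZMod L) = - v 0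
    · simp only [if_pos h1, if_pos h2]
      have : ∀ m : ℕ+, ((m : ℕ) : ℂ) ^ 2 * ((ZMod.stdAddChar (((m : ℕ) : ZMod L) * v 1)) - (ZMod.stdAddChar (-(((m : ℕ) : ZMod L) * v 1)))) * Function.Periodic.qParam (L : ℝ) τ ^ ((c : ℕ) * m)
       = ((m : ℕ) : ℂ) ^ 2 * ((ZMod.stdAddChar (((m : ℕ) : ZMod L) * v 1)) * Function.Periodic.qParam (L : ℝ) τ ^ ((c : ℕ) * m)) - ((m : ℕ) : ℂ) ^ 2 * ((ZMod.stdAddChar (-(((m : ℕ) : ZMod L) * v 1))) * Function.Periodic.qParam (L : ℝ) τ ^ ((c : ℕ) * m)) := by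
        intro m; ring
      simp_rw [this]
      rw [(hsq _).tsum_sub (hsq _)]
      field_simp
      ring
    · simp only [if_pos h1, if_neg h2, sub_zero, mul_zero, add_zero, mul_assoc]
      field_simp
    · simp only [if_neg h1, if_pos h2, zero_sub, mul_zero, zero_add, mul_assoc, mul_neg, neg_mul, tsum_neg]
      field_simp
    · simp [h1, h2]

lemma GG_he (L : ℕ) [NeZero L] (v : Fin 2 → ZMod L) (hv : v 0 = 0 → v 1 ≠ 0) :
    HasExpansion L (GG L v) (sc L v) := by
  rw [he_iff]
  intro τ
  rw [GG_eq L v hv τ]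
  have h1 := (summable_dterm L v τ).hasSum
  rw [← sigmaAntidiagonalEquivProd.hasSum_iff] at h1
  have h3 : HasSum (fun n : ℕ+ => sc L v n • Function.Periodic.qParam (L : ℝ) τ ^ (n : ℕ))
      (∑' x : ℕ+ × ℕ+, dterm L v τ (x.1, x.2)) := by
    refine HasSum.sigma h1 (fun n => ?_)
    have key : sc L v n • Function.Periodic.qParam (L : ℝ) τ ^ (n : ℕ) =
        ∑ x : {x // x ∈ (n : ℕ).divisorsAntidiagonal}, dterm L v τ x.1 := by
      rw [sc, if_neg n.pos.ne', Finset.sum_smul, ← Finset.sum_coe_sort]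
      refine Finset.sum_congr rfl fun x _ => ?_
      have hx := (Nat.mem_divisorsAntidiagonal.mp x.2).1
      rw [dterm, hx, smul_eq_mul]
    rw [key]
    exact hasSum_fintype _
  rw [hasSum_pnat_iff (f := fun n : ℕ => sc L v n • Function.Periodic.qParam (L : ℝ) τ ^ n)] at h3
  simpa [add_comm] using h3

lemma Phi_map (σ : ℂ →+* ℂ) (x : ℂ) : σ (Phi x) = Phi (σ x) := by
  simp [Phi]

lemma sc_map (L : ℕ) [NeZero L] (σ : ℂ →+* ℂ) (lam : ZMod L)
    (hσ : ∀ b : ZMod L, σ (ZMod.stdAddChar b) = ZMod.stdAddChar (lam * b)) (v : Fin 2 → ZMod L) (n : ℕ) :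
    σ (sc L v n) = sc L ![v 0, lam * v 1] n := by
  unfold sc
  split_ifs with h1 h2 h3 h4
  · rw [Phi_map, hσ]; simp
  · simp at h3; exact absurd h2 h3
  · simp at h4; exact absurd h4 h2
  · simp
  · rw [map_sum]
    refine Finset.sum_congr rfl fun x _ => ?_
    have e1 : lam * ((x.2 : ZMod L) * v 1) = x.2 * (lam * v 1) := by ring
    have e2 : lam * -((x.2 : ZMod L) * v 1) = -(x.2 * (lam * v 1)) := by ring
    simp only [map_mul, map_pow, map_natCast, map_sub, apply_ite σ, map_zero, hσ, e1, e2,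
      Matrix.cons_val_zero, Matrix.cons_val_one]
    rfl

lemma Phi_exp (α : ℝ) (h : Real.sin α ≠ 0) : Phi (cexp (2 * α * Complex.I)) =
    ((Real.cos α / Real.sin α ^ 3 : ℝ) : ℂ) * (1 / (4 * Complex.I)) := by
  have h' : Complex.sin α ≠ 0 := by
    rw [← Complex.ofReal_sin]; exact_mod_cast h
  have hx : cexp (2 * α * Complex.I) = (Complex.cos α + Complex.sin α * Complex.I) ^ 2 := by
    rw [← Complex.exp_mul_I, ← Complex.exp_nat_mul]; congr 1; push_cast; ring
  have hu : (Complex.cos α + Complex.sin α * Complex.I) ≠ 0 := by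
    rw [← Complex.exp_mul_I]; exact Complex.exp_ne_zero _
  have hsc := Complex.sin_sq_add_cos_sq (α : ℂ)
  rw [hx, Phi]
  push_cast
  set s := Complex.sin α
  set c := Complex.cos α
  have e1 : 1 - (c + s * Complex.I) ^ 2 = -2 * Complex.I * s * (c + s * Complex.I) := by
    linear_combination (-1 : ℂ) * hsc - s ^ 2 * Complex.I_sq + 2 * s ^ 2 * Complex.I_sq
  have e2 : 1 + (c + s * Complex.I) ^ 2 = 2 * c * (c + s * Complex.I) := by
    linear_combination (-1 : ℂ) * hsc + s ^ 2 * Complex.I_sq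
  rw [e1, e2]
  have hI := Complex.I_ne_zero
  have e3 : (-2 * Complex.I * s * (c + s * Complex.I)) ^ 3 = 8 * Complex.I * s ^ 3 * (c + s * Complex.I) ^ 3 := by
    have : Complex.I ^ 3 = - Complex.I := by rw [pow_succ, Complex.I_sq]; ring
    calc _ = -8 * Complex.I ^ 3 * s ^ 3 * (c + s * Complex.I) ^ 3 := by ring
      _ = _ := by rw [this]; ring
  rw [e3]
  field_simp
  ring

lemma sc_sep0 (L : ℕ) [NeZero L] (hL : 3 ≤ L) (w : Fin 2 → ZMod L) (hw : w 0 = 0 → w 1 ≠ 0)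
    (hne : w ≠ ![0, 1]) : sc L ![0, 1] 0 ≠ sc L w 0 := by
  have hLr : (3 : ℝ) ≤ L := by exact_mod_cast hL
  have hpi := Real.pi_pos
  have : Fact (1 < L) := ⟨by omega⟩
  have form : ∀ b : ZMod L, b ≠ 0 → Phi (ZMod.stdAddChar b) =
      ((Real.cos (π * b.val / L) / Real.sin (π * b.val / L) ^ 3 : ℝ) : ℂ) * (1 / (4 * Complex.I))
      ∧ 0 < Real.sin (π * b.val / L) := by
    intro b hb
    have hpos : 0 < Real.sin (π * b.val / L) := by
      have h0 : 0 < b.val := Nat.pos_of_ne_zero (by simpa using hb)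
      have h0' : (0 : ℝ) < b.val := by exact_mod_cast h0
      have h1 : (b.val : ℝ) < L := by exact_mod_cast b.val_lt
      apply Real.sin_pos_of_pos_of_lt_pi
      · positivity
      · rw [div_lt_iff₀ (by linarith)]
        gcongr
    refine ⟨?_, hpos⟩
    rw [← Phi_exp _ hpos.ne', char_val]
    congr 2
    push_cast
    ring
  obtain ⟨e1, p1⟩ := form 1 one_ne_zero
  rw [ZMod.val_one] at e1 p1
  have hc1 : 0 < Real.cos (π * (1 : ℕ) / L) := by
    apply Real.cos_pos_of_mem_Ioo
    constructor
    · have : 0 < π * (1 : ℕ) / L := by positivity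
      linarith
    · rw [div_lt_div_iff₀ (by linarith) (by norm_num)]
      push_cast
      nlinarith
  have hI : (1 / (4 * Complex.I)) ≠ 0 := by simp
  simp only [sc, if_true, Matrix.cons_val_zero, Matrix.cons_val_one]
  rw [e1]
  split_ifs with h0
  · have hw1 := hw h0
    obtain ⟨e2, p2⟩ := form (w 1) hw1
    rw [e2]
    intro h
    have h := mul_right_cancel₀ hI h
    have h : Real.cos (π * (1 : ℕ) / L) / Real.sin (π * (1 : ℕ) / L) ^ 3 =
      Real.cos (π * (w 1).val / L) / Real.sin (π * (w 1).val / L) ^ 3 := by exact_mod_cast h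
    have hv1 : (w 1).val ≠ 1 := by
      intro h1
      apply hne
      have : w 1 = 1 := by
        rw [← ZMod.natCast_zmod_val (w 1), h1]; simp
      ext i
      fin_cases i
      · simpa using h0
      · simpa using this
    have hv2 : 1 < (w 1).val := by
      have : (w 1).val ≠ 0 := by simpa using hw1
      omega
    have hlt : π * (1 : ℕ) / L < π * (w 1).val / L := by
      have : ((1 : ℕ) : ℝ) < (w 1).val := by exact_mod_cast hv2
      gcongr
    have h0' : 0 < π * (1 : ℕ) / L := by positivity
    have hval : π * (w 1).val / L < π := by
      have h1 : ((w 1).val : ℝ) < L := by exact_mod_cast (w 1).val_lt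
      rw [div_lt_iff₀ (by linarith)]
      gcongr
    rcases le_or_gt (Real.cos (π * (w 1).val / L)) 0 with hc | hc
    · have a1 : Real.cos (π * (w 1).val / L) / Real.sin (π * (w 1).val / L) ^ 3 ≤ 0 :=
        div_nonpos_of_nonpos_of_nonneg hc (by positivity)
      have a2 : 0 < Real.cos (π * (1 : ℕ) / L) / Real.sin (π * (1 : ℕ) / L) ^ 3 := by positivity
      linarith
    · have b1 : π * (w 1).val / L < π / 2 := by
        by_contra hb
        push Not at hb
        have := Real.cos_nonpos_of_pi_div_two_le_of_le hb (by linarith)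
        linarith
      have b2 : Real.cos (π * (w 1).val / L) < Real.cos (π * (1 : ℕ) / L) :=
        Real.cos_lt_cos_of_nonneg_of_le_pi h0'.le hval.le hlt
      have b3 : Real.sin (π * (1 : ℕ) / L) < Real.sin (π * (w 1).val / L) :=
        Real.sin_lt_sin_of_lt_of_le_pi_div_two (by linarith) b1.le hlt
      have : Real.cos (π * (w 1).val / L) / Real.sin (π * (w 1).val / L) ^ 3 <
        Real.cos (π * (1 : ℕ) / L) / Real.sin (π * (1 : ℕ) / L) ^ 3 := by
        gcongr
      linarith
  · have : Real.cos (π * (1 : ℕ) / L) / Real.sin (π * (1 : ℕ) / L) ^ 3 ≠ 0 := by positivity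
    exact mul_ne_zero (by exact_mod_cast this) hI

lemma lift_row {L : ℕ} [NeZero L] (v : Fin 2 → ZMod L) (hv : ∃ x y : ZMod L, x * v 0 + y * v 1 = 1) :
    ∃ γ : SL(2, ℤ), actv ![0, 1] γ = v := by
  obtain ⟨x, y, hxy⟩ := hv
  have hLpos : 0 < L := Nat.pos_of_ne_zero (NeZero.ne L)
  set c : ℕ := (v 0).val + L with hc
  have hcpos : 0 < c := by omega
  have hcv : (c : ZMod L) = v 0 := by simp [hc]
  set d : ℕ := (v 1).val with hd
  have hdv : (d : ZMod L) = v 1 := by simp [hd]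
  set e : ℕ := Nat.gcd c L with he
  have hec : e ∣ c := Nat.gcd_dvd_left _ _
  have heL : e ∣ L := Nat.gcd_dvd_right _ _
  have : NeZero c := ⟨hcpos.ne'⟩
  have hunit : IsUnit (d : ZMod e) := by
    have h1 := congrArg (ZMod.castHom heL (ZMod e)) hxy
    rw [← hcv, ← hdv, map_add, map_mul, map_mul, map_one, map_natCast, map_natCast] at h1
    have h2 : (c : ZMod e) = 0 := (ZMod.natCast_eq_zero_iff _ _).mpr hec
    rw [h2, mul_zero, zero_add] at h1
    exact IsUnit.of_mul_eq_one _ (by rw [mul_comm]; exact h1)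
  obtain ⟨u, hu⟩ := hunit
  obtain ⟨z, hz⟩ := ZMod.unitsMap_surjective hec u
  have hz' : (((z : ZMod c).val : ℕ) : ZMod e) = d := by
    rw [← hu, ← hz, ZMod.unitsMap_val, ZMod.natCast_val]
  have hcop : IsCoprime (((z : ZMod c).val : ℕ) : ℤ) (c : ℤ) := by
    rw [Nat.isCoprime_iff_coprime]
    exact ZMod.val_coe_unit_coprime z
  have hdvd : (e : ℤ) ∣ (((z : ZMod c).val : ℕ) : ℤ) - d := by
    rw [← ZMod.intCast_zmod_eq_zero_iff_dvd]
    push_cast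
    rw [hz', sub_self]
  obtain ⟨t, ht⟩ := hdvd
  have hbez : (e : ℤ) = c * Nat.gcdA c L + L * Nat.gcdB c L := Nat.gcd_eq_gcd_ab c L
  set d' : ℤ := d + L * (Nat.gcdB c L * t) with hd'
  have hcop' : IsCoprime (c : ℤ) d' := by
    have : d' = (((z : ZMod c).val : ℕ) : ℤ) + c * (-(Nat.gcdA c L * t)) := by
      rw [hd']
      rw [hbez] at ht
      linear_combination -ht
    rw [this]
    exact (hcop.symm).add_mul_left_right _
  obtain ⟨γ, -, hγ⟩ := ModularGroup.bottom_row_surj (R := ℤ) (a := ![(c : ℤ), d']) (by simpa using hcop')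
  refine ⟨γ, ?_⟩
  have h0 : γ 1 0 = (c : ℤ) := congrFun hγ 0
  have h1 : γ 1 1 = d' := congrFun hγ 1
  ext i
  fin_cases i
  · simp [actv, h0, hcv]
  · simp [actv, h1, hd', hdv]

lemma prim_of_act {L : ℕ} (γ : SL(2, ℤ)) : ∃ x y : ZMod L, x * actv ![0, 1] γ 0 + y * actv ![0, 1] γ 1 = 1 := by
  have h := γ.2
  rw [Matrix.det_fin_two] at h
  refine ⟨-((γ 0 1 : ℤ) : ZMod L), ((γ 0 0 : ℤ) : ZMod L), ?_⟩
  have := congrArg (Int.cast : ℤ → ZMod L) h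
  push_cast at this
  simp only [actv, Matrix.cons_val_zero, Matrix.cons_val_one, zero_mul, one_mul, zero_add]
  linear_combination this

open Classical in
/-- primitive vectors -/
def VV (L : ℕ) [NeZero L] : Finset (Fin 2 → ZMod L) :=
  Finset.univ.filter fun v => ∃ γ : SL(2, ℤ), actv ![0, 1] γ = v

lemma mem_VV {L : ℕ} [NeZero L] {v : Fin 2 → ZMod L} : v ∈ VV L ↔ ∃ γ : SL(2, ℤ), actv ![0, 1] γ = v := by
  simp [VV]

lemma mem_VV' {L : ℕ} [NeZero L] {v : Fin 2 → ZMod L} : v ∈ VV L ↔ ∃ x y : ZMod L, x * v 0 + y * v 1 = 1 := by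
  rw [mem_VV]
  constructor
  · rintro ⟨γ, rfl⟩
    exact prim_of_act γ
  · exact lift_row v

lemma VV_act {L : ℕ} [NeZero L] {v : Fin 2 → ZMod L} (γ : SL(2, ℤ)) : actv v γ ∈ VV L ↔ v ∈ VV L := by
  rw [mem_VV, mem_VV]
  constructor
  · rintro ⟨δ, hδ⟩
    exact ⟨δ * γ⁻¹, actv_inj (γ := γ) (by rw [← actv_mul, inv_mul_cancel_right, hδ])⟩
  · rintro ⟨δ, rfl⟩
    exact ⟨δ * γ, actv_mul _ _ _⟩

def actT {L : ℕ} (lam : ZMod L) (v : Fin 2 → ZMod L) : Fin 2 → ZMod L := ![v 0, lam * v 1]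

lemma actT_inj {L : ℕ} (lam : (ZMod L)ˣ) : Function.Injective (actT (lam : ZMod L)) := by
  intro v w h
  have h0 : v 0 = w 0 := congrFun h 0
  have h1 : lam * v 1 = lam * w 1 := congrFun h 1
  ext i
  fin_cases i
  · exact h0
  · exact lam.isUnit.mul_left_cancel h1

lemma actT_mem {L : ℕ} [NeZero L] (lam : (ZMod L)ˣ) {v : Fin 2 → ZMod L} (hv : v ∈ VV L) :
    actT (lam : ZMod L) v ∈ VV L := by
  rw [mem_VV'] at *
  obtain ⟨x, y, h⟩ := hv
  refine ⟨x, y * (lam⁻¹ : (ZMod L)ˣ), ?_⟩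
  rw [← h]
  simp only [actT, Matrix.cons_val_zero, Matrix.cons_val_one]
  have : ((lam⁻¹ : (ZMod L)ˣ) : ZMod L) * lam = 1 := by simp
  linear_combination (y * v 1) * this

lemma VV_ne {L : ℕ} [NeZero L] (hL : 3 ≤ L) {v : Fin 2 → ZMod L} (hv : v ∈ VV L) : v 0 = 0 → v 1 ≠ 0 := by
  have : Fact (1 < L) := ⟨by omega⟩
  rw [mem_VV'] at hv
  obtain ⟨x, y, h⟩ := hv
  intro h0 h1
  rw [h0, h1] at h
  simp at h

lemma zero_one_mem_VV {L : ℕ} [NeZero L] : ![0, 1] ∈ VV L := mem_VV.mpr ⟨1, actv_one _⟩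

lemma GG_sep {L : ℕ} [NeZero L] (hL : 3 ≤ L) {v w : Fin 2 → ZMod L} (hv : v ∈ VV L) (hw : w ∈ VV L)
    (h : GG L v = GG L w) : v = w := by
  obtain ⟨γ, rfl⟩ := mem_VV.mp hv
  by_contra hne
  have key : GG L ![0, 1] = GG L (actv w γ⁻¹) := by
    ext τ
    have := congrFun h (γ⁻¹ • τ)
    rw [GG_slash, GG_slash, ← actv_mul, mul_inv_cancel, actv_one] at this
    exact mul_left_cancel₀ (pow_ne_zero _ (denom_ne_zero _ _)) this
  have hw' : actv w γ⁻¹ ∈ VV L := (VV_act _).mpr hw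
  have h1 := GG_he L ![0, 1] (VV_ne hL zero_one_mem_VV)
  have h2 := GG_he L _ (VV_ne hL hw')
  rw [key] at h1
  have := he_unique (by omega) h1 h2
  refine sc_sep0 L hL _ (VV_ne hL hw') ?_ (congrFun this 0)
  intro h3
  apply hne
  rw [← h3, ← actv_mul, inv_mul_cancel, actv_one]

section interp
open Polynomial
variable {R S ι : Type*} [CommRing R] [CommRing S] [Fintype ι] [DecidableEq ι]

/-- interpolation polynomial -/
def interp (F H : ι → R) : R[X] := ∑ v, C (F v) * ∏ w ∈ Finset.univ.erase v, (X - C (H w))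

lemma interp_eval (F H : ι → R) (v : ι) :
    (interp F H).eval (H v) = F v * ∏ w ∈ Finset.univ.erase v, (H v - H w) := by
  unfold interp
  rw [eval_finsetSum, Finset.sum_eq_single v]
  · simp [eval_prod]
  · intro u _ hu
    rw [eval_mul, eval_prod, Finset.prod_eq_zero (i := v)]
    · simp
    · simp [hu.symm]
    · simp
  · simp

lemma interp_map (φ : R →+* S) (F H : ι → R) :
    (interp F H).map φ = interp (φ ∘ F) (φ ∘ H) := by
  simp [interp, Polynomial.map_sum, Polynomial.map_prod]

lemma prod_erase_perm (e : Equiv.Perm ι) (g : ι → R) (v : ι) :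
    ∏ w ∈ Finset.univ.erase v, g (e w) = ∏ w ∈ Finset.univ.erase (e v), g w := by
  refine Finset.prod_equiv e ?_ ?_
  · intro i; simp
  · intro i _; rfl

lemma interp_perm (e : Equiv.Perm ι) (F H : ι → R) : interp (F ∘ e) (H ∘ e) = interp F H := by
  unfold interp
  rw [← Equiv.sum_comp e (fun v => C (F v) * ∏ w ∈ Finset.univ.erase v, (X - C (H w)))]
  refine Finset.sum_congr rfl fun v _ => ?_
  rw [← prod_erase_perm e (fun w => X - C (H w))]
  rfl

lemma interp_scale (a b : ℂ) (hb : b ≠ 0) (F H : ι → ℂ) (i : ℕ) :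
    (interp (fun v => a * F v) (fun v => b * H v)).coeff i =
      a * b ^ ((Fintype.card ι : ℤ) - 1 - i) * (interp F H).coeff i := by
  rcases isEmpty_or_nonempty ι with hι | hι
  · simp [interp]
  have h : (interp (fun v => a * F v) (fun v => b * H v)).comp (C b * X) =
      C (a * b ^ (Fintype.card ι - 1)) * interp F H := by
    unfold interp
    rw [Polynomial.comp, Polynomial.eval₂_finsetSum, Finset.mul_sum]
    refine Finset.sum_congr rfl fun v _ => ?_
    rw [← Polynomial.comp, Polynomial.mul_comp, Polynomial.prod_comp, C_comp]
    have : ∀ w, (X - C (b * H w)).comp (C b * X) = C b * (X - C (H w)) := by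
      intro w
      simp [mul_sub]
    simp_rw [this]
    rw [Finset.prod_mul_distrib, Finset.prod_const, Finset.card_erase_of_mem (Finset.mem_univ _),
      Finset.card_univ, C_mul, C_mul, C_pow]
    ring
  have h2 := congrArg (fun p => coeff p i) h
  simp only [Polynomial.comp_C_mul_X_coeff, coeff_C_mul] at h2
  have hc : 1 ≤ Fintype.card ι := Fintype.card_pos
  have e : b ^ ((Fintype.card ι : ℤ) - 1 - i) = b ^ (Fintype.card ι - 1) / b ^ i := by
    rw [zpow_sub₀ hb, zpow_natCast, ← zpow_natCast b (Fintype.card ι - 1), Nat.cast_sub hc, Nat.cast_one]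
  rw [e, mul_div_assoc', div_mul_eq_mul_div, eq_div_iff (pow_ne_zero _ hb)]
  exact h2
end interp

lemma mkLevelOne {L : ℕ} (hL : 1 ≤ L) {k : ℤ} {F : ℍ → ℂ} {c : ℕ → ℂ} (hc : HasExpansion L F c)
    (hF : ∀ (γ : SL(2, ℤ)) (τ : ℍ), F (γ • τ) = (denom γ τ) ^ k * F τ) :
    ∃ M : ModularForm 𝒮ℒ k, ⇑M = F := by
  have hsl : ∀ γ : SL(2, ℤ), F ∣[k] γ = F := by
    intro γ
    ext τ
    rw [ModularForm.SL_slash_apply, hF, mul_comm, ← mul_assoc, ← zpow_add₀ (denom_ne_zero _ _)]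
    simp
  refine ⟨{ toFun := F
            slash_action_eq' := ?_
            holo' := he_holo hL hc
            bdd_at_cusps' := ?_ }, rfl⟩
  · rintro _ ⟨γ, rfl⟩
    exact hsl γ
  · intro cc hcc
    rw [Subgroup.IsArithmetic.isCusp_iff_isCusp_SL2Z] at hcc
    rw [OnePoint.isBoundedAt_iff_forall_SL2Z hcc]
    intro γ _
    rw [hsl]
    exact he_bdd hL hc

abbrev II (L : ℕ) [NeZero L] := {v : Fin 2 → ZMod L // v ∈ VV L}

/-- evaluation at a point -/
def evτ (L : ℕ) (τ : ℍ) : ExRing L →+* ℂ :=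
  (Pi.evalRingHom (fun _ : ℍ => ℂ) τ).comp ((RingHom.fst _ _).comp (ExRing L).subtype)

/-- expansion -/
def exq (L : ℕ) : ExRing L →+* PowerSeries ℂ := (RingHom.snd _ _).comp (ExRing L).subtype

lemma evτ_inj {L : ℕ} (hL : 1 ≤ L) {x y : ExRing L} (h : ∀ τ, evτ L τ x = evτ L τ y) : x = y :=
  ExRing_fst_inj hL (funext h)

lemma exq_inj {L : ℕ} {x y : ExRing L} (h : exq L x = exq L y) : x = y := ExRing_snd_inj h

/-- the Eisenstein series as an element of the ring of expansions -/
def HH (L : ℕ) [NeZero L] (hL : 3 ≤ L) (v : II L) : ExRing L :=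
  ⟨(GG L v.1, PowerSeries.mk (sc L v.1)), by
    rw [mem_ExRing]; simpa using GG_he L v.1 (VV_ne hL v.2)⟩

def actI {L : ℕ} [NeZero L] (γ : SL(2, ℤ)) : Equiv.Perm (II L) where
  toFun v := ⟨actv v.1 γ, (VV_act γ).mpr v.2⟩
  invFun v := ⟨actv v.1 γ⁻¹, (VV_act γ⁻¹).mpr v.2⟩
  left_inv v := Subtype.ext (by simp [← actv_mul, actv_one])
  right_inv v := Subtype.ext (by simp [← actv_mul, actv_one])

def TI {L : ℕ} [NeZero L] (lam : (ZMod L)ˣ) : Equiv.Perm (II L) :=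
  Equiv.ofBijective (fun v => (⟨actT (lam : ZMod L) v.1, actT_mem lam v.2⟩ : II L)) (by
    rw [← Finite.injective_iff_bijective]
    intro v w h
    exact Subtype.ext (actT_inj lam (congrArg Subtype.val h)))

def oI {L : ℕ} [NeZero L] : II L := ⟨![0, 1], zero_one_mem_VV⟩

lemma HH_act {L : ℕ} [NeZero L] (hL : 3 ≤ L) (γ : SL(2, ℤ)) (v : II L) (τ : ℍ) :
    evτ L (γ • τ) (HH L hL v) = (denom γ τ) ^ 3 * evτ L τ (HH L hL (actI γ v)) :=
  GG_slash L v.1 γ τ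

lemma HH_inj {L : ℕ} [NeZero L] (hL : 3 ≤ L) {v w : II L} (h : HH L hL v = HH L hL w) : v = w :=
  Subtype.ext (GG_sep hL v.2 w.2 (congrArg (fun x => x.1.1) h))

lemma exq_HH {L : ℕ} [NeZero L] (hL : 3 ≤ L) (v : II L) (n : ℕ) :
    PowerSeries.coeff n (exq L (HH L hL v)) = sc L v.1 n := by
  have : exq L (HH L hL v) = PowerSeries.mk (sc L v.1) := rfl
  rw [this, PowerSeries.coeff_mk]

lemma TI_val {L : ℕ} [NeZero L] (lam : (ZMod L)ˣ) (v : II L) : (TI lam v).1 = actT (lam : ZMod L) v.1 := rfl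

lemma HH_map {L : ℕ} [NeZero L] (hL : 3 ≤ L) (σ : ℂ →+* ℂ) (lam : (ZMod L)ˣ)
    (hσ : ∀ b : ZMod L, σ (ZMod.stdAddChar b) = ZMod.stdAddChar ((lam : ZMod L) * b)) (v : II L) :
    PowerSeries.map σ (exq L (HH L hL v)) = exq L (HH L hL (TI lam v)) := by
  ext n
  rw [PowerSeries.coeff_map, exq_HH, exq_HH, TI_val]
  exact sc_map L σ lam hσ v.1 n

open Classical in
def DD (L : ℕ) [NeZero L] (hL : 3 ≤ L) (u : II L) : ExRing L :=
  ∏ w ∈ Finset.univ.erase u, (HH L hL u - HH L hL w)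

lemma DD_ne {L : ℕ} [NeZero L] (hL : 3 ≤ L) (u : II L) : exq L (DD L hL u) ≠ 0 := by
  classical
  unfold DD
  rw [map_prod, Finset.prod_ne_zero_iff]
  intro w hw h
  rw [map_sub, sub_eq_zero] at h
  have := HH_inj hL (exq_inj h)
  rw [this] at hw
  simp at hw

lemma DD_act {L : ℕ} [NeZero L] (hL : 3 ≤ L) (γ : SL(2, ℤ)) (u : II L) (τ : ℍ) :
    evτ L (γ • τ) (DD L hL u) = ((denom γ τ) ^ 3) ^ (Fintype.card (II L) - 1) * evτ L τ (DD L hL (actI γ u)) := by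
  classical
  unfold DD
  rw [map_prod, map_prod, ← prod_erase_perm (actI γ) (fun w => evτ L τ (HH L hL (actI γ u) - HH L hL w))]
  have : ∀ w, evτ L (γ • τ) (HH L hL u - HH L hL w) = (denom γ τ) ^ 3 * evτ L τ (HH L hL (actI γ u) - HH L hL (actI γ w)) := by
    intro w
    rw [map_sub, map_sub, HH_act, HH_act]
    ring
  simp_rw [this]
  rw [Finset.prod_mul_distrib, Finset.prod_const, Finset.card_erase_of_mem (Finset.mem_univ _), Finset.card_univ]

/-- the twisted interpolation polynomial -/
lemma exists_Q {L : ℕ} [NeZero L] (hL : 3 ≤ L) {k : ℤ} (σ : ℂ →+* ℂ) (lam : (ZMod L)ˣ)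
    (hσ : ∀ b : ZMod L, σ (ZMod.stdAddChar b) = ZMod.stdAddChar ((lam : ZMod L) * b))
    (F : II L → ExRing L)
    (hF : ∀ (γ : SL(2, ℤ)) (v : II L) (τ : ℍ), evτ L (γ • τ) (F v) = (denom γ τ) ^ k * evτ L τ (F (actI γ v))) :
    ∃ Q : Polynomial (ExRing L),
      (∀ (γ : SL(2, ℤ)) (τ : ℍ) (u : II L), evτ L (γ • τ) (Q.eval (HH L hL u)) =
        (denom γ τ) ^ k * ((denom γ τ) ^ 3) ^ (Fintype.card (II L) - 1) * evτ L τ (Q.eval (HH L hL (actI γ u)))) ∧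
      (∀ v : II L, exq L (Q.eval (HH L hL (TI lam v))) =
        PowerSeries.map σ (exq L (F v)) * exq L (DD L hL (TI lam v))) := by
  classical
  have hL1 : 1 ≤ L := by omega
  set P : Polynomial (ExRing L) := interp F (HH L hL) with hP
  have hcard : 1 ≤ Fintype.card (II L) := Fintype.card_pos_iff.mpr ⟨oI⟩
  have hcoef : ∀ (i : ℕ) (γ : SL(2, ℤ)) τ, evτ L (γ • τ) (P.coeff i) =
      (denom γ τ) ^ (k + 3 * ((Fintype.card (II L) : ℤ) - 1 - (i : ℤ))) * evτ L τ (P.coeff i) := by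
    intro i γ τ
    have hd : denom γ τ ≠ 0 := denom_ne_zero _ _
    rw [← Polynomial.coeff_map, ← Polynomial.coeff_map, hP, interp_map, interp_map,
      ← interp_perm (actI γ) (evτ L τ ∘ F)]
    have e1 : (evτ L (γ • τ) ∘ F) = fun v => (denom γ τ) ^ k * ((evτ L τ ∘ F) ∘ actI γ) v := by
      ext v; exact hF γ v τ
    have e2 : (evτ L (γ • τ) ∘ HH L hL) = fun v => (denom γ τ) ^ 3 * ((evτ L τ ∘ HH L hL) ∘ actI γ) v := by
      ext v; exact HH_act hL γ v τ
    rw [e1, e2, interp_scale _ _ (pow_ne_zero _ hd), zpow_add₀ hd, zpow_mul]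
    rfl
  have hM : ∀ i : ℕ, ∃ M : ModularForm 𝒮ℒ (k + 3 * ((Fintype.card (II L) : ℤ) - 1 - (i : ℤ))),
      ((⇑M : ℍ → ℂ), PowerSeries.map σ (exq L (P.coeff i))) ∈ ExRing L := by
    intro i
    obtain ⟨M, hM⟩ := mkLevelOne hL1 (mem_ExRing.mp (P.coeff i).2) (hcoef i)
    obtain ⟨M', p, hp, hp'⟩ := levelOne_twist hL1 σ
      ((k + 3 * ((Fintype.card (II L) : ℤ) - 1 - (i : ℤ))).toNat + 1) _ (by push_cast; omega) M
    refine ⟨M', ?_⟩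
    have : (⟨_, hp⟩ : ExRing L) = P.coeff i := ExRing_fst_inj hL1 hM
    have h2 : p = exq L (P.coeff i) := by rw [← this]; rfl
    rwa [h2] at hp'
  choose M hM using hM
  set m : ℕ → ExRing L := fun i => ⟨_, hM i⟩ with hm
  set Q : Polynomial (ExRing L) := ∑ i ∈ Finset.range (P.natDegree + 1), Polynomial.C (m i) * Polynomial.X ^ i with hQ
  have hmact : ∀ (i : ℕ) (γ : SL(2, ℤ)) τ, evτ L (γ • τ) (m i) =
      (denom γ τ) ^ (k + 3 * ((Fintype.card (II L) : ℤ) - 1 - (i : ℤ))) * evτ L τ (m i) := by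
    intro i γ τ
    have h1 : (⇑(M i)) ∣[(k + 3 * ((Fintype.card (II L) : ℤ) - 1 - (i : ℤ)))] γ = ⇑(M i) :=
      (M i).slash_action_eq' _ ⟨γ, rfl⟩
    have h2 := congrFun h1 τ
    rw [ModularForm.SL_slash_apply, zpow_neg, ← div_eq_mul_inv,
      div_eq_iff (zpow_ne_zero _ (denom_ne_zero _ _))] at h2
    exact h2.trans (mul_comm _ _)
  have hmq : ∀ i, exq L (m i) = PowerSeries.map σ (exq L (P.coeff i)) := fun i => rfl
  clear_value m
  refine ⟨Q, ?_, ?_⟩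
  · intro γ τ u
    have hd : denom γ τ ≠ 0 := denom_ne_zero _ _
    simp only [hQ, Polynomial.eval_finsetSum, Polynomial.eval_mul, Polynomial.eval_C, Polynomial.eval_pow,
      Polynomial.eval_X, map_sum, map_mul, map_pow, Finset.mul_sum]
    refine Finset.sum_congr rfl fun i _ => ?_
    rw [hmact, HH_act]
    have e : (denom γ τ) ^ (k + 3 * ((Fintype.card (II L) : ℤ) - 1 - (i : ℤ))) * ((denom γ τ) ^ 3) ^ i
        = (denom γ τ) ^ k * ((denom γ τ) ^ 3) ^ (Fintype.card (II L) - 1) := by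
      rw [← pow_mul, ← pow_mul, ← zpow_natCast, ← zpow_natCast, ← zpow_add₀ hd, ← zpow_add₀ hd]
      congr 1
      push_cast [Nat.cast_sub hcard]
      ring
    rw [mul_pow, ← e]
    ring
  · intro v
    have hmap : Q.map (exq L) = (P.map (exq L)).map (PowerSeries.map σ) := by
      conv_rhs => rw [P.as_sum_range_C_mul_X_pow]
      simp only [hQ, Polynomial.map_sum, Polynomial.map_mul, Polynomial.map_C, Polynomial.map_pow, Polynomial.map_X]
      refine Finset.sum_congr rfl fun i _ => ?_
      rw [hmq i]
    have h1 : exq L (Q.eval (HH L hL (TI lam v))) = (Q.map (exq L)).eval (exq L (HH L hL (TI lam v))) := by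
      rw [Polynomial.eval_map_apply]
    rw [h1, hmap, hP, interp_map, interp_map, ← HH_map hL σ lam hσ v]
    have h2 := interp_eval (PowerSeries.map σ ∘ exq L ∘ F) (PowerSeries.map σ ∘ exq L ∘ HH L hL) v
    refine h2.trans ?_
    simp only [Function.comp]
    congr 1
    unfold DD
    rw [map_prod, ← prod_erase_perm (TI lam) (fun w => exq L (HH L hL (TI lam v) - HH L hL w))]
    refine Finset.prod_congr rfl fun w _ => ?_
    rw [map_sub, HH_map hL σ lam hσ, HH_map hL σ lam hσ]

lemma exists_Lγ (L : ℕ) (s : ℤ) : ∃ γ : SL(2, ℤ), γ 0 0 = 1 ∧ γ 0 1 = 0 ∧ γ 1 0 = s * L ∧ γ 1 1 = 1 :=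
  ⟨⟨!![1, 0; s * L, 1], by simp [Matrix.det_fin_two]⟩, by simp, by simp, by simp, by simp⟩

lemma core {L : ℕ} [NeZero L] (hL : 3 ≤ L) {k : ℤ} (hk : 1 ≤ k) (σ : ℂ →+* ℂ) (lam : (ZMod L)ˣ)
    (hσ : ∀ b : ZMod L, σ (ZMod.stdAddChar b) = ZMod.stdAddChar ((lam : ZMod L) * b))
    (F : II L → ExRing L)
    (hF : ∀ (γ : SL(2, ℤ)) (v : II L) (τ : ℍ), evτ L (γ • τ) (F v) = (denom γ τ) ^ k * evτ L τ (F (actI γ v)))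
    (e : ℂ) (he : PowerSeries.map σ (exq L (F oI)) = exq L (F oI) + PowerSeries.C e)
    (γ : SL(2, ℤ)) (v : II L) (hv : TI lam v = actI γ (TI lam oI)) :
    PowerSeries.map σ (exq L (F v)) = exq L (F (actI γ oI)) := by
  have hL1 : 1 ≤ L := by omega
  obtain ⟨Q, hQ1, hQ2⟩ := exists_Q hL σ lam hσ F hF
  set E : ExRing L := ⟨((fun _ => e), PowerSeries.C e), const_mem_ExRing L e⟩ with hE
  have hEq : exq L E = PowerSeries.C e := rfl
  have hEt : ∀ τ, evτ L τ E = e := fun τ => rfl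
  clear_value E
  have h0 : Q.eval (HH L hL (TI lam oI)) = (F oI + E) * DD L hL (TI lam oI) := by
    apply exq_inj
    rw [hQ2, he, map_mul, map_add, hEq]
  have h1 : ∀ (γ : SL(2, ℤ)) (τ : ℍ), (denom γ τ) ^ k * evτ L τ (Q.eval (HH L hL (actI γ (TI lam oI)))) =
      ((denom γ τ) ^ k * evτ L τ (F (actI γ oI)) + e) * evτ L τ (DD L hL (actI γ (TI lam oI))) := by
    intro γ τ
    have hd : denom γ τ ≠ 0 := denom_ne_zero _ _
    have h2 := hQ1 γ τ (TI lam oI)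
    rw [h0, map_mul, map_add, hEt, hF, DD_act] at h2
    have h3 : ((denom γ τ) ^ 3) ^ (Fintype.card (II L) - 1) ≠ 0 := pow_ne_zero _ (pow_ne_zero _ hd)
    apply mul_left_cancel₀ h3
    linear_combination -h2
  have he0 : e = 0 := by
    by_contra hne
    have hDD : ∃ τ, evτ L τ (DD L hL (TI lam oI)) ≠ 0 := by
      by_contra hcon
      push Not at hcon
      apply DD_ne hL (TI lam oI)
      have : DD L hL (TI lam oI) = 0 := evτ_inj hL1 (fun τ => by rw [hcon, map_zero])
      rw [this, map_zero]
    obtain ⟨τ, hτ⟩ := hDD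
    have hs : ∃ s : ℤ, 0 ≤ s * τ.re ∧ s ≠ 0 := by
      rcases le_total 0 τ.re with h | h
      · exact ⟨1, by simpa using h, by simp⟩
      · exact ⟨-1, by simpa using h, by simp⟩
    obtain ⟨s, hs, hs0⟩ := hs
    obtain ⟨δ, d1, d2, d3, d4⟩ := exists_Lγ L s
    have hfix : ∀ w : II L, w.1 0 = 0 → actI δ w = w := by
      intro w hw
      apply Subtype.ext
      change actv w.1 δ = w.1
      ext i
      fin_cases i <;> simp [actv, d1, d2, d3, d4, hw]
    have f1 : actI δ (oI : II L) = oI := hfix _ (by simp [oI])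
    have f2 : actI δ (TI lam (oI : II L)) = TI lam oI := hfix _ (by rw [TI_val]; simp [actT, oI])
    have a1 := h1 1 τ
    have a2 := h1 δ τ
    have g1 : actI (1 : SL(2, ℤ)) (oI : II L) = oI := Subtype.ext (actv_one _)
    have g2 : actI (1 : SL(2, ℤ)) (TI lam (oI : II L)) = TI lam oI := Subtype.ext (actv_one _)
    rw [f1, f2] at a2
    rw [g1, g2] at a1
    have hd1 : denom (1 : SL(2, ℤ)) τ = 1 := by simp
    rw [hd1, one_zpow, one_mul, one_mul] at a1
    rw [a1] at a2
    have hj : (denom δ τ) ^ k = 1 := by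
      have : e * evτ L τ (DD L hL (TI lam oI)) * ((denom δ τ) ^ k - 1) = 0 := by linear_combination a2
      rcases mul_eq_zero.mp this with h | h
      · exact absurd h (mul_ne_zero hne hτ)
      · exact sub_eq_zero.mp h
    have hden : denom δ τ = (s * L : ℂ) * τ + 1 := by
      rw [ModularGroup.denom_apply, d3, d4]; push_cast; ring
    have hre : 1 < Complex.normSq (denom δ τ) := by
      have r1 : (denom δ τ).re = s * L * τ.re + 1 := by rw [hden]; simp
      have r2 : (denom δ τ).im = s * L * τ.im := by rw [hden]; simp
      rw [Complex.normSq_apply, r1, r2]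
      have hLp : (0 : ℝ) < L := by exact_mod_cast hL1
      have hsr : (s : ℝ) ≠ 0 := by exact_mod_cast hs0
      have q1 : 0 < ((s : ℝ) * L * τ.im) * (s * L * τ.im) := by
        apply mul_self_pos.mpr
        exact mul_ne_zero (mul_ne_zero hsr hLp.ne') τ.im_pos.ne'
      have q2 : 0 ≤ (s : ℝ) * L * τ.re := by
        have := mul_nonneg hLp.le hs
        nlinarith
      nlinarith
    have hno : 1 < Complex.normSq ((denom δ τ) ^ k) := by
      rw [map_zpow₀]
      exact one_lt_zpow₀ hre (by omega)
    rw [hj] at hno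
    simp at hno
  have h4 : Q.eval (HH L hL (actI γ (TI lam oI))) = F (actI γ oI) * DD L hL (actI γ (TI lam oI)) := by
    apply evτ_inj hL1
    intro τ
    have hd : denom γ τ ≠ 0 := denom_ne_zero _ _
    have h5 := h1 γ τ
    rw [he0] at h5
    apply mul_left_cancel₀ (zpow_ne_zero k hd)
    rw [h5, map_mul]
    ring
  have h6 := hQ2 v
  rw [hv, h4, map_mul] at h6
  exact (mul_right_cancel₀ (DD_ne hL _) h6).symm

lemma lift_ringHom {R S T : Type} [CommRing R] [IsDomain R] [Field S] [Field T] [IsAlgClosed T] [Algebra R S]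
    (hinj : Function.Injective (algebraMap R S)) [Algebra.IsAlgebraic R S] (h : R →+* T) (hh : Function.Injective h) :
    ∃ σ : S →+* T, ∀ r, σ (algebraMap R S r) = h r := by
  let : Algebra R T := h.toAlgebra
  have : FaithfulSMul R S := (faithfulSMul_iff_algebraMap_injective R S).mpr hinj
  have : FaithfulSMul R T := (faithfulSMul_iff_algebraMap_injective R T).mpr hh
  let φ : S →ₐ[R] T := IsAlgClosed.lift
  exact ⟨φ, fun r => φ.commutes r⟩

lemma extend_poly {A ι : Type} [Field A] [Algebra A ℂ] (v : ι → ℂ) (hv : IsTranscendenceBasis A v)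
    (θ : MvPolynomial ι A →+* MvPolynomial ι A) (hθ : Function.Injective θ) :
    ∃ σ : ℂ →+* ℂ, ∀ p, σ (MvPolynomial.aeval v p) = MvPolynomial.aeval v (θ p) := by
  have := hv.isAlgebraic
  obtain ⟨σ, hσ⟩ := lift_ringHom (R := Algebra.adjoin A (Set.range v)) (S := ℂ) (T := ℂ) Subtype.val_injective
    ((((MvPolynomial.aeval (R := A) v : MvPolynomial ι A →ₐ[A] ℂ) : MvPolynomial ι A →+* ℂ).comp θ).comp
      (hv.1.aevalEquiv.symm : Algebra.adjoin A (Set.range v) →+* MvPolynomial ι A))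
    (by
      rw [RingHom.coe_comp, RingHom.coe_comp]
      exact (Function.Injective.comp hv.1 hθ).comp hv.1.aevalEquiv.symm.injective)
  refine ⟨σ, fun p => ?_⟩
  have := hσ (hv.1.aevalEquiv p)
  simpa using this

lemma exists_move (K : Subfield ℂ) (x : ℂ) (hx : x ∉ K) :
    ∃ σ : ℂ →+* ℂ, (∀ y ∈ K, σ y = y) ∧ σ x ≠ x := by
  by_cases halg : IsAlgebraic K x
  · let A := algebraicClosure K ℂ
    have : IsAlgClosure K A := inferInstance
    have : Normal K A := IsAlgClosure.normal K A
    have : IsGalois K A := {}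
    let x' : A := ⟨x, mem_algebraicClosure_iff.mpr halg⟩
    have : ∃ τ : Gal(A/K), τ x' ≠ x' := by
      by_contra hcon
      push Not at hcon
      rw [← InfiniteGalois.mem_bot_iff_fixed, IntermediateField.mem_bot] at hcon
      obtain ⟨y, hy⟩ := hcon
      apply hx
      have : (y : ℂ) = x := congrArg Subtype.val hy
      rw [← this]
      exact y.2
    obtain ⟨τ, hτ⟩ := this
    obtain ⟨s, hs⟩ := exists_isTranscendenceBasis A ℂ
    obtain ⟨σ, hσ⟩ := extend_poly _ hs (MvPolynomial.map (τ : A →+* A))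
      (MvPolynomial.map_injective _ τ.injective)
    have hC : ∀ z : A, σ z = τ z := by
      intro z
      have := hσ (MvPolynomial.C z)
      rw [MvPolynomial.map_C, MvPolynomial.aeval_C, MvPolynomial.aeval_C] at this
      exact this
    refine ⟨σ, ?_, ?_⟩
    · intro y hy
      have h1 := hC (algebraMap K A ⟨y, hy⟩)
      rw [τ.commutes] at h1
      exact h1
    · intro h
      apply hτ
      exact Subtype.ext ((hC x').symm.trans h)
  · have hind : AlgebraicIndepOn K id ({x} : Set ℂ) := by
      exact (algebraicIndependent_unique_type_iff (R := K)).mpr halg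
    obtain ⟨s, hxs, hs⟩ := exists_isTranscendenceBasis_superset hind
    have hθ : Function.Injective (MvPolynomial.aeval (R := K) (fun i : s => (MvPolynomial.X i + 1 : MvPolynomial s K))) := by
      apply Function.LeftInverse.injective
        (g := MvPolynomial.aeval (R := K) (fun i : s => (MvPolynomial.X i - 1 : MvPolynomial s K)))
      intro p
      have : ((MvPolynomial.aeval (R := K) (fun i : s => (MvPolynomial.X i - 1 : MvPolynomial s K))).comp
        (MvPolynomial.aeval (R := K) (fun i : s => (MvPolynomial.X i + 1 : MvPolynomial s K)))) = AlgHom.id K _ := by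
        ext i
        simp
      exact DFunLike.congr_fun this p
    obtain ⟨σ, hσ⟩ := extend_poly _ hs
      ((MvPolynomial.aeval (R := K) (fun i : s => (MvPolynomial.X i + 1 : MvPolynomial s K)) :
        MvPolynomial s K →ₐ[K] MvPolynomial s K) : MvPolynomial s K →+* MvPolynomial s K) hθ
    refine ⟨σ, ?_, ?_⟩
    · intro y hy
      have h1 := hσ (MvPolynomial.C ⟨y, hy⟩)
      simp only [RingHom.coe_coe, MvPolynomial.aeval_C, MvPolynomial.algebraMap_eq] at h1
      exact h1
    · have h1 := hσ (MvPolynomial.X ⟨x, hxs rfl⟩)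
      simp only [RingHom.coe_coe, MvPolynomial.aeval_X, map_add, map_one] at h1
      rw [h1]
      simp

lemma exists_lam {L : ℕ} [NeZero L] (hL : 3 ≤ L) (σ : ℂ →+* ℂ) : ∃ lam : (ZMod L)ˣ,
    ∀ b : ZMod L, σ (ZMod.stdAddChar b) = ZMod.stdAddChar ((lam : ZMod L) * b) := by
  have h1 : IsPrimitiveRoot (ZMod.stdAddChar (1 : ZMod L)) L := by
    have : Fact (1 < L) := ⟨by omega⟩
    rw [char_val, ZMod.val_one]
    have := Complex.isPrimitiveRoot_exp L (NeZero.ne L)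
    simpa using this
  have h2 := h1.map_of_injective σ.injective
  rw [h1.isPrimitiveRoot_iff] at h2
  obtain ⟨i, -, hi, h3⟩ := h2
  refine ⟨ZMod.unitOfCoprime i hi, fun b => ?_⟩
  rw [ZMod.coe_unitOfCoprime]
  have hb : ZMod.stdAddChar b = (ZMod.stdAddChar (1 : ZMod L)) ^ b.val := by
    rw [← AddChar.map_nsmul_eq_pow]; simp
  have hib : ZMod.stdAddChar ((i : ZMod L) * b) = ((ZMod.stdAddChar (1 : ZMod L)) ^ i) ^ b.val := by
    rw [← AddChar.map_nsmul_eq_pow, ← AddChar.map_nsmul_eq_pow]; simp [mul_comm]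
  rw [hb, hib, map_pow, h3]

open scoped Manifold in
lemma he_of_periodic {L : ℕ} (hL : 1 ≤ L) {F : ℍ → ℂ} (hol : MDiff F) (hb : IsBoundedAtImInfty F)
    (hp : ∀ τ : ℍ, F ((L : ℝ) +ᵥ τ) = F τ) : ∃ p : PowerSeries ℂ, (F, p) ∈ ExRing L := by
  have hLp : (0 : ℝ) < L := by exact_mod_cast hL
  have hper : Function.Periodic (F ∘ ofComplex) (L : ℝ) := by
    intro w
    by_cases hw : 0 < w.im
    · have hw' : 0 < (w + (L : ℝ)).im := by simpa using hw
      simp only [Function.comp_apply, ofComplex_apply_of_im_pos hw, ofComplex_apply_of_im_pos hw']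
      rw [← hp ⟨w, hw⟩]
      congr 1
      ext
      simp [add_comm]
    · have hw' : ¬ 0 < (w + (L : ℝ)).im := by simpa using hw
      simp only [Function.comp_apply]
      rw [ofComplex_apply_of_im_nonpos (not_lt.mp hw), ofComplex_apply_of_im_nonpos (not_lt.mp hw')]
  refine ⟨qExpansion L F, ?_⟩
  rw [mem_ExRing, he_iff]
  exact fun τ => UpperHalfPlane.hasSum_qExpansion hLp hper hol hb τ

lemma slash_eq_of {N : ℕ} {k : ℤ} (χ : DirichletCharacter ℂ N) (f : ℍ → ℂ)
    (hχf : ∀ γ : SL(2, ℤ), γ ∈ Gamma0 N → f ∣[k] γ = χ ((γ 1 1 : ℤ) : ZMod N) • f)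
    (γ δ : SL(2, ℤ)) (h1 : (((δ * γ⁻¹) 1 0 : ℤ) : ZMod N) = 0)
    (h2 : χ (((δ * γ⁻¹) 1 1 : ℤ) : ZMod N) = 1) : f ∣[k] δ = f ∣[k] γ := by
  have h3 := hχf (δ * γ⁻¹) (by rw [Gamma0_mem]; exact h1)
  rw [h2, one_smul] at h3
  conv_rhs => rw [← h3, ← SlashAction.slash_mul, inv_mul_cancel_right]

lemma slash_eq_of_row {N L : ℕ} (hNL : N ∣ L) {k : ℤ} (χ : DirichletCharacter ℂ N) (f : ℍ → ℂ)
    (hχf : ∀ γ : SL(2, ℤ), γ ∈ Gamma0 N → f ∣[k] γ = χ ((γ 1 1 : ℤ) : ZMod N) • f)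
    (γ δ : SL(2, ℤ)) (h : actv (![0, 1] : Fin 2 → ZMod L) δ = actv ![0, 1] γ) : f ∣[k] δ = f ∣[k] γ := by
  have h1 : actv (![0, 1] : Fin 2 → ZMod L) (δ * γ⁻¹) = ![0, 1] := by
    rw [actv_mul, h, ← actv_mul, mul_inv_cancel, actv_one]
  have a0 := congrFun h1 0
  have a1 := congrFun h1 1
  simp only [actv, Matrix.cons_val_zero, Matrix.cons_val_one, zero_mul, zero_add, one_mul] at a0 a1
  have b0 := congrArg (ZMod.castHom hNL (ZMod N)) a0
  have b1 := congrArg (ZMod.castHom hNL (ZMod N)) a1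
  rw [map_intCast, map_zero] at b0
  rw [map_intCast, map_one] at b1
  exact slash_eq_of χ f hχf γ δ b0 (by rw [b1, map_one])

lemma exists_F {N L : ℕ} [NeZero L] (hNL : N ∣ L) {k : ℤ} (χ : DirichletCharacter ℂ N)
    (f : ModularForm (Gamma1 N) k) (hN : 1 ≤ N)
    (hχf : ∀ γ : SL(2, ℤ), γ ∈ Gamma0 N → ⇑f ∣[k] γ = χ ((γ 1 1 : ℤ) : ZMod N) • ⇑f) (v : II L) :
    ∃ x : ExRing L, ∀ δ : SL(2, ℤ), actv ![0, 1] δ = v.1 → x.1.1 = ⇑f ∣[k] δ := by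
  obtain ⟨γ, hγ⟩ := mem_VV.mp v.2
  have hL : 1 ≤ L := Nat.pos_of_ne_zero (NeZero.ne L)
  have : NeZero N := ⟨by omega⟩
  obtain ⟨p, hp⟩ := he_of_periodic (F := ⇑f ∣[k] γ) hL
    (by exact (ModularFormClass.holo f).slash k _)
    (ModularFormClass.bdd_at_infty_slash f γ) (by
      intro τ
      have e00 : (ModularGroup.T ^ (L : ℤ)) 0 0 = 1 := by
        change (ModularGroup.T ^ (L : ℤ)).1 0 0 = 1
        rw [ModularGroup.coe_T_zpow]; simp
      have e01 : (ModularGroup.T ^ (L : ℤ)) 0 1 = L := by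
        change (ModularGroup.T ^ (L : ℤ)).1 0 1 = L
        rw [ModularGroup.coe_T_zpow]; simp
      have e10 : (ModularGroup.T ^ (L : ℤ)) 1 0 = 0 := by
        change (ModularGroup.T ^ (L : ℤ)).1 1 0 = 0
        rw [ModularGroup.coe_T_zpow]; simp
      have e11 : (ModularGroup.T ^ (L : ℤ)) 1 1 = 1 := by
        change (ModularGroup.T ^ (L : ℤ)).1 1 1 = 1
        rw [ModularGroup.coe_T_zpow]; simp
      have hvadd := UpperHalfPlane.modular_T_zpow_smul τ (L : ℤ)
      have hden := ModularGroup.denom_apply (ModularGroup.T ^ (L : ℤ)) τ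
      rw [e10, e11] at hden
      generalize ModularGroup.T ^ (L : ℤ) = t at *
      have h1 : ⇑f ∣[k] (γ * t) = ⇑f ∣[k] γ := by
        apply slash_eq_of_row hNL χ _ hχf
        rw [actv_mul]
        ext i
        fin_cases i <;> simp [actv, e00, e01, e10, e11]
      have h2 := congrFun h1 τ
      rw [SlashAction.slash_mul, ModularForm.SL_slash_apply, hvadd, hden] at h2
      rw [← h2]
      simp)
  refine ⟨⟨_, hp⟩, fun δ hδ => ?_⟩
  exact (slash_eq_of_row hNL χ _ hχf γ δ (hδ.trans hγ.symm)).symm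

lemma chi_one {N m : ℕ} (hN : 1 ≤ N) (χ : DirichletCharacter ℂ N) (hm : m = χ.conductor) (z : ℤ)
    (hu : IsUnit (z : ZMod N)) (hz : (m : ℤ) ∣ z - 1) : χ (z : ZMod N) = 1 := by
  have hf := χ.factorsThrough_conductor
  rw [← hm] at hf
  have h1 := hf.eq_changeLevel
  obtain ⟨u, hu⟩ := hu
  rw [h1, ← hu, DirichletCharacter.changeLevel_eq_cast_of_dvd, hu]
  have : ((z : ZMod N).cast : ZMod m) = 1 := by
    rw [ZMod.cast_intCast hf.dvd]
    have := (ZMod.intCast_zmod_eq_zero_iff_dvd (z - 1) m).mpr hz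
    push_cast at this
    exact sub_eq_zero.mp this
  rw [this, map_one]

lemma dvd_aux {N : ℕ} (x y : ℤ) (h : ((N / Int.gcd x N : ℕ) : ℤ) ∣ y) : (N : ℤ) ∣ y * x := by
  have h1 : (Int.gcd x N) ∣ N := by exact_mod_cast Int.gcd_dvd_right x (N : ℤ)
  have h2 : (N : ℤ) = ((N / Int.gcd x N : ℕ) : ℤ) * (Int.gcd x N : ℤ) := by
    exact_mod_cast (Nat.div_mul_cancel h1).symm
  calc (N : ℤ) = ((N / Int.gcd x N : ℕ) : ℤ) * (Int.gcd x N : ℤ) := h2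
    _ ∣ y * x := mul_dvd_mul h (Int.gcd_dvd_left _ _)

lemma zeta_fix {L M : ℕ} [NeZero L] (hML : M ∣ L) (σ : ℂ →+* ℂ) (lam : (ZMod L)ˣ)
    (hσ : ∀ b : ZMod L, σ (ZMod.stdAddChar b) = ZMod.stdAddChar ((lam : ZMod L) * b))
    (hz : σ (zetaC M) = zetaC M) (u : ℤ) (hu : (u : ZMod L) = ((lam⁻¹ : (ZMod L)ˣ) : ZMod L)) :
    (M : ℤ) ∣ u - 1 := by
  obtain ⟨t, rfl⟩ := hML
  have hne : M * t ≠ 0 := NeZero.ne _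
  have hM0 : (M : ℂ) ≠ 0 := by exact_mod_cast left_ne_zero_of_mul hne
  have ht0 : (t : ℂ) ≠ 0 := by exact_mod_cast right_ne_zero_of_mul hne
  have h1 : zetaC M = ZMod.stdAddChar ((t : ℤ) : ZMod (M * t)) := by
    rw [ZMod.stdAddChar_coe, zetaC]
    congr 1
    push_cast
    field_simp
  rw [h1, hσ] at hz
  have h2 := ZMod.injective_stdAddChar hz
  have h3 : (((u - 1) * t : ℤ) : ZMod (M * t)) = 0 := by
    push_cast
    rw [hu]
    have h4 : ((lam⁻¹ : (ZMod (M * t))ˣ) : ZMod (M * t)) * lam = 1 := by simp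
    push_cast at h2
    linear_combination (t : ZMod (M * t)) * h4 - ((lam⁻¹ : (ZMod (M * t))ˣ) : ZMod (M * t)) * h2
  rw [ZMod.intCast_zmod_eq_zero_iff_dvd] at h3
  push_cast at h3
  exact Int.dvd_of_mul_dvd_mul_right (by exact_mod_cast right_ne_zero_of_mul hne) h3

lemma gamma_eq {N L m : ℕ} (hN : 1 ≤ N) (hNL : N ∣ L) {k : ℤ}
    (χ : DirichletCharacter ℂ N) (hm : m = χ.conductor) (f : ℍ → ℂ)
    (hχf : ∀ γ : SL(2, ℤ), γ ∈ Gamma0 N → f ∣[k] γ = χ ((γ 1 1 : ℤ) : ZMod N) • f)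
    (g γ : SL(2, ℤ)) (u : ℤ)
    (h1 : (N : ℤ) ∣ (u - 1) * (g 1 0 * g 1 1)) (h2 : (m : ℤ) ∣ (u - 1) * (g 0 1 * g 1 0))
    (hγ : actv (![0, 1] : Fin 2 → ZMod L) γ = ![(u : ZMod L) * (g 1 0 : ℤ), ((g 1 1 : ℤ) : ZMod L)]) :
    f ∣[k] γ = f ∣[k] g := by
  have a0 := congrFun hγ 0
  have a1 := congrFun hγ 1
  simp only [actv, Matrix.cons_val_zero, Matrix.cons_val_one, zero_mul, zero_add, one_mul] at a0 a1
  have b0 : (L : ℤ) ∣ γ 1 0 - u * g 1 0 := by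
    rw [← ZMod.intCast_zmod_eq_zero_iff_dvd]; push_cast; rw [a0, sub_self]
  have b1 : (L : ℤ) ∣ γ 1 1 - g 1 1 := by
    rw [← ZMod.intCast_zmod_eq_zero_iff_dvd]; push_cast; rw [a1, sub_self]
  have hNL' : (N : ℤ) ∣ L := by exact_mod_cast hNL
  have hmN : (m : ℤ) ∣ N := by rw [hm]; exact_mod_cast χ.conductor_dvd_level
  have hdet := g.det_coe
  rw [Matrix.det_fin_two] at hdet
  have i10 : (γ * g⁻¹) 1 0 = γ 1 0 * g 1 1 - γ 1 1 * g 1 0 := by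
    simp [Matrix.SpecialLinearGroup.coe_mul, Matrix.mul_apply, Fin.sum_univ_two, Matrix.SpecialLinearGroup.coe_inv, Matrix.adjugate_fin_two]
    ring
  have i11 : (γ * g⁻¹) 1 1 = - γ 1 0 * g 0 1 + γ 1 1 * g 0 0 := by
    simp [Matrix.SpecialLinearGroup.coe_mul, Matrix.mul_apply, Fin.sum_univ_two, Matrix.SpecialLinearGroup.coe_inv, Matrix.adjugate_fin_two]
  have c10 : (N : ℤ) ∣ (γ * g⁻¹) 1 0 := by
    have : (γ * g⁻¹) 1 0 = (γ 1 0 - u * g 1 0) * g 1 1 - (γ 1 1 - g 1 1) * g 1 0 + (u - 1) * (g 1 0 * g 1 1) := by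
      rw [i10]; ring
    rw [this]
    exact dvd_add (dvd_sub ((hNL'.trans b0).mul_right _) ((hNL'.trans b1).mul_right _)) h1
  have c11 : (m : ℤ) ∣ (γ * g⁻¹) 1 1 - 1 := by
    have : (γ * g⁻¹) 1 1 - 1 = - ((γ 1 0 - u * g 1 0) * g 0 1) + (γ 1 1 - g 1 1) * g 0 0 - (u - 1) * (g 0 1 * g 1 0) := by
      rw [i11]; linear_combination hdet
    rw [this]
    have hmL := hmN.trans hNL'
    exact dvd_sub (dvd_add (dvd_neg.mpr ((hmL.trans b0).mul_right _)) ((hmL.trans b1).mul_right _)) h2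
  have z10 := (ZMod.intCast_zmod_eq_zero_iff_dvd _ N).mpr c10
  refine slash_eq_of χ f hχf g γ z10 (chi_one hN χ hm _ ?_ c11)
  have hdet' := (γ * g⁻¹).det_coe
  rw [Matrix.det_fin_two] at hdet'
  have := congrArg (Int.cast : ℤ → ZMod N) hdet'
  push_cast [z10] at this
  rw [mul_zero, sub_zero] at this
  exact IsUnit.of_mul_eq_one_right _ this

lemma sigma_fix (N : ℕ) (hN : 1 ≤ N) (k : ℤ) (hk : 1 ≤ k)
    (χ : DirichletCharacter ℂ N) (m : ℕ) (hm : m = χ.conductor)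
    (f : ModularForm (Gamma1 N) k)
    (hχf : ∀ γ : SL(2, ℤ), γ ∈ Gamma0 N →
      ⇑f ∣[k] γ = χ ((γ 1 1 : ℤ) : ZMod N) • ⇑f)
    (a : ℕ → ℂ) (ha : HasExpansion 1 (⇑f) a)
    (g : SL(2, ℤ)) (N' m' M : ℕ)
    (hN' : N' = N / Int.gcd (g 1 0 * g 1 1) N)
    (hm' : m' = m / Int.gcd (g 0 1 * g 1 0) m)
    (hM : M = Nat.lcm N' m')
    (c : ℕ → ℂ) (hc : HasExpansion N (⇑f ∣[k] g) c) (σ : ℂ →+* ℂ)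
    (hσa : ∀ j, 1 ≤ j → σ (a j) = a j) (hσz : σ (zetaC M) = zetaC M) (n : ℕ) : σ (c n) = c n := by
  obtain ⟨L, hLdef⟩ : ∃ L, L = N * 3 := ⟨_, rfl⟩
  have hL : 3 ≤ L := by omega
  have hL1 : 1 ≤ L := by omega
  have : NeZero L := ⟨by omega⟩
  have hNL : N ∣ L := ⟨3, hLdef⟩
  have hmN : m ∣ N := by rw [hm]; exact χ.conductor_dvd_level
  have hN'N : N' ∣ N := by
    rw [hN']; exact Nat.div_dvd_of_dvd (by exact_mod_cast Int.gcd_dvd_right (g 1 0 * g 1 1) (N : ℤ))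
  have hm'm : m' ∣ m := by
    rw [hm']; exact Nat.div_dvd_of_dvd (by exact_mod_cast Int.gcd_dvd_right (g 0 1 * g 1 0) (m : ℤ))
  have hMN : M ∣ N := by rw [hM]; exact Nat.lcm_dvd hN'N (hm'm.trans hmN)
  obtain ⟨lam, hlam⟩ := exists_lam hL σ
  choose F hF using exists_F hNL χ f hN hχf
  have hFact : ∀ (γ : SL(2, ℤ)) (v : II L) (τ : ℍ),
      evτ L (γ • τ) (F v) = (denom γ τ) ^ k * evτ L τ (F (actI γ v)) := by
    intro γ v τ
    obtain ⟨δ, hδ⟩ := mem_VV.mp v.2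
    have h1 := hF v δ hδ
    have h2 := hF (actI γ v) (δ * γ) (by rw [actv_mul, hδ]; rfl)
    have e1 : evτ L (γ • τ) (F v) = (⇑f ∣[k] δ) (γ • τ) := congrFun h1 _
    have e2 : evτ L τ (F (actI γ v)) = (⇑f ∣[k] (δ * γ)) τ := congrFun h2 _
    rw [e1, e2, SlashAction.slash_mul, ModularForm.SL_slash_apply (⇑f ∣[k] δ), mul_left_comm,
      ← zpow_add₀ (denom_ne_zero _ _), add_neg_cancel, zpow_zero, mul_one]
  -- the expansion of the form itself
  have hFo : (F oI).1.1 = ⇑f := by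
    rw [hF oI 1 (actv_one _), SlashAction.slash_one]
  have hco : ∀ n, PowerSeries.coeff n (exq L (F oI)) = if L ∣ n then a (n / L) else 0 := by
    have h1 := mem_ExRing.mp (F oI).2
    rw [hFo] at h1
    have h2 := he_expand hL1 le_rfl ha
    rw [one_mul] at h2
    exact congrFun (he_unique hL1 h1 h2)
  have he : PowerSeries.map σ (exq L (F oI)) = exq L (F oI) + PowerSeries.C (σ (a 0) - a 0) := by
    ext i
    rw [PowerSeries.coeff_map, map_add, hco, PowerSeries.coeff_C]
    by_cases hi : i = 0
    · subst hi
      simp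
    · rw [if_neg hi, add_zero]
      split_ifs with hd
      · exact hσa _ (Nat.div_pos (Nat.le_of_dvd (Nat.pos_of_ne_zero hi) hd) hL1)
      · exact map_zero σ
  -- the twisted matrix
  obtain ⟨u, hu⟩ := ZMod.intCast_surjective ((lam⁻¹ : (ZMod L)ˣ) : ZMod L)
  have hMu := zeta_fix (hMN.trans hNL) σ lam hlam hσz u hu
  have hul : (lam : ZMod L) * u = 1 := by rw [hu]; simp
  have hdet := g.det_coe
  rw [Matrix.det_fin_two] at hdet
  have hdetL : ((g 0 0 : ℤ) : ZMod L) * (g 1 1 : ℤ) - ((g 0 1 : ℤ) : ZMod L) * (g 1 0 : ℤ) = 1 := by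
    exact_mod_cast congrArg (Int.cast : ℤ → ZMod L) hdet
  obtain ⟨γ, hγ⟩ := lift_row ![(u : ZMod L) * ((g 1 0 : ℤ) : ZMod L), ((g 1 1 : ℤ) : ZMod L)]
    ⟨-((g 0 1 : ℤ) : ZMod L) * lam, ((g 0 0 : ℤ) : ZMod L), by
      simp only [Matrix.cons_val_zero, Matrix.cons_val_one]
      linear_combination hdetL - ((g 0 1 : ℤ) : ZMod L) * (g 1 0 : ℤ) * hul⟩
  have hfe : ⇑f ∣[k] γ = ⇑f ∣[k] g := by
    refine gamma_eq hN hNL χ hm _ hχf g γ u (dvd_aux _ _ ?_) (dvd_aux _ _ ?_) hγ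
    · rw [← hN']
      refine dvd_trans ?_ hMu
      rw [hM]; exact_mod_cast Nat.dvd_lcm_left _ _
    · rw [← hm']
      refine dvd_trans ?_ hMu
      rw [hM]; exact_mod_cast Nat.dvd_lcm_right _ _
  set v : II L := actI g oI with hvdef
  have hv : TI lam v = actI γ (TI lam oI) := by
    apply Subtype.ext
    have b0 := congrFun hγ 0
    have b1 := congrFun hγ 1
    simp only [actv, Matrix.cons_val_zero, Matrix.cons_val_one, zero_mul, zero_add, one_mul] at b0 b1
    change actT (lam : ZMod L) (actv ![0, 1] g) = actv (actT (lam : ZMod L) ![0, 1]) γ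
    ext i
    fin_cases i
    · simp only [actT, actv, Matrix.cons_val_zero, Matrix.cons_val_one, Fin.zero_eta, Fin.mk_one]
      rw [b0]
      linear_combination -((g 1 0 : ℤ) : ZMod L) * hul
    · simp only [actT, actv, Matrix.cons_val_zero, Matrix.cons_val_one, Fin.zero_eta, Fin.mk_one]
      rw [b1]
      ring
  have hcore := core hL hk σ lam hlam F hFact _ he γ v hv
  have hFv : (F v).1.1 = ⇑f ∣[k] g := hF v g rfl
  have hFg : (F (actI γ oI)).1.1 = ⇑f ∣[k] g := by rw [hF (actI γ oI) γ rfl, hfe]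
  rw [← ExRing_fst_inj hL1 (hFv.trans hFg.symm)] at hcore
  have hcv : ∀ n, PowerSeries.coeff n (exq L (F v)) = if 3 ∣ n then c (n / 3) else 0 := by
    have h1 := mem_ExRing.mp (F v).2
    rw [hFv] at h1
    have h2 := he_expand (d := 3) (by norm_num) hN hc
    rw [← hLdef] at h2
    exact congrFun (he_unique hL1 h1 h2)
  have h3 := congrArg (PowerSeries.coeff (3 * n)) hcore
  rw [PowerSeries.coeff_map, hcv] at h3
  simpa using h3

/-- Let `χ` be a Dirichlet character modulo `N` of conductor `m`,
`f ∈ M_k(Γ₀(N), χ)`, `g = (A,B;C,D) ∈ SL₂(ℤ)`. Set `N' = N/gcd(CD,N)`,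
`m' = m/gcd(BC,m)`, `M = lcm(N',m')`. Then every Fourier coefficient of `f|_k g`
(in its expansion `Σ_{n≥0} c_n e^{2πinτ/N}`) lies in the subfield `K_f(ζ_M)` of `ℂ`. -/
theorem stmt_9 (N : ℕ) (hN : 1 ≤ N) (k : ℤ) (hk : 1 ≤ k)
    (χ : DirichletCharacter ℂ N) (m : ℕ) (hm : m = χ.conductor)
    (f : ModularForm (Gamma1 N) k)
    (hχf : ∀ γ : SL(2, ℤ), γ ∈ Gamma0 N →
      ⇑f ∣[k] γ = χ ((γ 1 1 : ℤ) : ZMod N) • ⇑f)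
    (a : ℕ → ℂ) (ha : HasExpansion 1 (⇑f) a)
    (g : SL(2, ℤ)) (N' m' M : ℕ)
    (hN' : N' = N / Int.gcd (g 1 0 * g 1 1) N)
    (hm' : m' = m / Int.gcd (g 0 1 * g 1 0) m)
    (hM : M = Nat.lcm N' m')
    (c : ℕ → ℂ) (hc : HasExpansion N (⇑f ∣[k] g) c) :
    ∀ n : ℕ, c n ∈ Subfield.closure ({x : ℂ | ∃ j : ℕ, 1 ≤ j ∧ x = a j} ∪ {zetaC M}) := by
  intro n
  by_contra hn
  obtain ⟨σ, hσ, hne⟩ := exists_move _ _ hn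
  apply hne
  refine sigma_fix N hN k hk χ m hm f hχf a ha g N' m' M hN' hm' hM c hc σ ?_ ?_ n
  · intro j hj
    exact hσ _ (Subfield.subset_closure (Or.inl ⟨j, hj, rfl⟩))
  · exact hσ _ (Subfield.subset_closure (Or.inr rfl))
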